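/- arXiv:1909.05578 — 10 statements merged into one kernel-verified Lean document; each statement's English description precedes it below -/
import Mathlib

section
/- Let φ and g be probability densities on ℝ, each symmetric unimodal about 0, and suppose the integrals below are finite. Define U(μ) := ∫_ℝ δ·φ(δ − μ)·( ∫_{−δ}^{0} g(s) ds ) dδ, where ∫_{−δ}^{0} denotes the signed integral. Then: (i) U(−μ) = U(μ) for all μ ∈ ℝ; (ii) U(0) ≤ U(μ) for all μ ∈ ℝ, i.e., μ = 0 minimizes U; and (iii) U is strictly increasing with respect to |μ|: whenever 0 ≤ μ₂ < μ₁, U(μ₂) < U(μ₁). -/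
open MeasureTheory intervalIntegral

/-- A probability density on `ℝ`: measurable, nonnegative, integrating to 1. -/
def IsDensity (f : ℝ → ℝ) : Prop :=
  Measurable f ∧ (∀ x, 0 ≤ f x) ∧ ∫ x, f x = 1

/-- `f` is symmetric unimodal about `ξ`. -/
def SymmUnimodal (f : ℝ → ℝ) (ξ : ℝ) : Prop :=
  IsDensity f ∧ (∀ x, f (ξ + x) = f (ξ - x)) ∧
    ∀ x y, |y - ξ| ≤ |x - ξ| → f x ≤ f y

theorem aux_integrable {f : ℝ → ℝ} (hf : SymmUnimodal f 0) : Integrable f := by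
  by_contra h
  have := hf.1.2.2
  rw [integral_undef h] at this
  norm_num at this

theorem aux_even {f : ℝ → ℝ} (hf : SymmUnimodal f 0) (x : ℝ) : f (-x) = f x := by
  have := hf.2.1 x
  simp only [zero_add, zero_sub] at this
  exact this.symm

theorem aux_mono {f : ℝ → ℝ} (hf : SymmUnimodal f 0) {x y : ℝ} (h : |y| ≤ |x|) :
    f x ≤ f y := hf.2.2 x y (by simpa using h)

/-- decay -/
theorem aux_decay {f : ℝ → ℝ} (hf : SymmUnimodal f 0) {x : ℝ} (hx : 0 < x) :
    f x ≤ 1 / x := by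
  have hi := aux_integrable hf
  have h1 : ∫ s in (0:ℝ)..x, f x ≤ ∫ s in (0:ℝ)..x, f s := by
    apply intervalIntegral.integral_mono_on hx.le (by simp) hi.intervalIntegrable
    intro s hs
    apply aux_mono hf
    rw [abs_of_nonneg hs.1, abs_of_pos hx]; exact hs.2
  have h2 : ∫ s in (0:ℝ)..x, f s ≤ 1 := by
    rw [intervalIntegral.integral_of_le hx.le, ← hf.1.2.2]
    exact setIntegral_le_integral hi (Filter.Eventually.of_forall hf.1.2.1)
  rw [intervalIntegral.integral_const] at h1
  simp only [sub_zero, smul_eq_mul] at h1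
  rw [le_div_iff₀ hx]
  linarith

/-- not a.e. periodic -/
theorem aux_nonper {f : ℝ → ℝ} (hf : SymmUnimodal f 0) {d : ℝ} (hd : 0 < d) :
    ¬ (∀ᵐ x : ℝ, f (x + d) = f x) := by
  intro h
  have h1 : ∀ n : ℕ, ∀ᵐ x : ℝ, f (x + n * d + d) = f (x + n * d) := fun n =>
    (measurePreserving_add_right volume ((n:ℝ) * d)).quasiMeasurePreserving.ae h
  have h2 : ∀ᵐ x : ℝ, f x = 0 := by
    filter_upwards [ae_all_iff.2 h1] with x hx
    have h3 : ∀ n : ℕ, f (x + n * d) = f x := by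
      intro n
      induction n with
      | zero => simp
      | succ k ih =>
        rw [← ih, ← hx k]; congr 1; push_cast; ring
    have ht : Filter.Tendsto (fun n : ℕ => x + n * d) Filter.atTop Filter.atTop :=
      Filter.tendsto_atTop_add_const_left _ _
        (tendsto_natCast_atTop_atTop.atTop_mul_const hd)
    have ht2 : Filter.Tendsto (fun n : ℕ => 1 / (x + n * d)) Filter.atTop (nhds 0) := by
      simpa [Function.comp_def] using tendsto_inv_atTop_zero.comp ht
    refine le_antisymm ?_ (hf.1.2.1 x)
    refine ge_of_tendsto ht2 ?_
    filter_upwards [ht.eventually_gt_atTop 0] with n hn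
    rw [← h3 n]
    exact aux_decay hf hn
  have h4 := hf.1.2.2
  rw [integral_congr_ae h2] at h4
  simp at h4

/-- The weight function. -/
noncomputable def auxH (g : ℝ → ℝ) (δ : ℝ) : ℝ := δ * (∫ s in (-δ)..(0 : ℝ), g s)

theorem auxH_even {g : ℝ → ℝ} (hg : SymmUnimodal g 0) (x : ℝ) : auxH g (-x) = auxH g x := by
  unfold auxH
  have h : ∫ s in (0:ℝ)..x, g s = ∫ s in (-x)..(0:ℝ), g s := by
    have := intervalIntegral.integral_comp_neg (a := 0) (b := x) g
    simp only [aux_even hg, neg_zero] at this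
    exact this
  rw [neg_neg, intervalIntegral.integral_symm, h]; ring

theorem aux_pos {g : ℝ → ℝ} (hg : SymmUnimodal g 0) : ∃ e, 0 < e ∧ 0 < g e := by
  by_contra! hc
  have h2 : ∀ᵐ x : ℝ, g x = 0 := by
    filter_upwards [compl_mem_ae_iff.2 (measure_singleton (0:ℝ))] with x hx
    have hx : x ≠ 0 := by simpa using hx
    refine le_antisymm ?_ (hg.1.2.1 x)
    exact (aux_mono hg (by simp)).trans (hc |x| (abs_pos.2 hx))
  have h4 := hg.1.2.2
  rw [integral_congr_ae h2] at h4
  simp at h4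

theorem auxH_lt {g : ℝ → ℝ} (hg : SymmUnimodal g 0) {x y : ℝ} (h : |x| < |y|) :
    auxH g x < auxH g y := by
  have habs : ∀ z, auxH g z = auxH g |z| := by
    intro z
    rcases abs_choice z with h | h <;> rw [h]
    rw [auxH_even hg]
  rw [habs x, habs y]
  have hx : 0 ≤ |x| := abs_nonneg x
  generalize |x| = a at *
  generalize |y| = b at *
  have hi := aux_integrable hg
  unfold auxH
  have hb : 0 < b := by linarith
  have hsplit : (∫ s in (-b)..(-a), g s) + ∫ s in (-a)..(0:ℝ), g s = ∫ s in (-b)..(0:ℝ), g s :=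
    intervalIntegral.integral_add_adjacent_intervals hi.intervalIntegrable hi.intervalIntegrable
  have h1 : 0 ≤ ∫ s in (-b)..(-a), g s :=
    intervalIntegral.integral_nonneg (by linarith) (fun u _ => hg.1.2.1 u)
  have hpos : 0 < ∫ s in (-b)..(0:ℝ), g s := by
    obtain ⟨e, he, hge⟩ := aux_pos hg
    set c := min e b
    have hc : 0 < c := lt_min he hb
    have s1 : (∫ s in (-b)..(-c), g s) + ∫ s in (-c)..(0:ℝ), g s = ∫ s in (-b)..(0:ℝ), g s :=
      intervalIntegral.integral_add_adjacent_intervals hi.intervalIntegrable hi.intervalIntegrable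
    have s2 : 0 ≤ ∫ s in (-b)..(-c), g s :=
      intervalIntegral.integral_nonneg (by linarith [min_le_right e b]) (fun u _ => hg.1.2.1 u)
    have s3 : ∫ s in (-c)..(0:ℝ), g e ≤ ∫ s in (-c)..(0:ℝ), g s := by
      apply intervalIntegral.integral_mono_on (by linarith) (by simp) hi.intervalIntegrable
      intro s hs
      apply aux_mono hg
      rw [abs_of_nonpos hs.2, abs_of_pos he]
      linarith [hs.1, min_le_left e b]
    rw [intervalIntegral.integral_const] at s3
    have : 0 < c * g e := mul_pos hc hge
    simp only [smul_eq_mul] at s3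
    linarith
  calc a * ∫ s in (-a)..(0:ℝ), g s ≤ a * ∫ s in (-b)..(0:ℝ), g s :=
        mul_le_mul_of_nonneg_left (by linarith) hx
    _ < b * ∫ s in (-b)..(0:ℝ), g s := mul_lt_mul_of_pos_right h hpos

theorem aux_strict (φ g : ℝ → ℝ) (hφ : SymmUnimodal φ 0) (hg : SymmUnimodal g 0)
    (hint : ∀ μ, Integrable (fun δ : ℝ => auxH g δ * φ (δ - μ)))
    (a b : ℝ) (hb : 0 ≤ b) (hab : b < a) :
    ∫ δ, auxH g δ * φ (δ - b) < ∫ δ, auxH g δ * φ (δ - a) := by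
  have e1 : ∀ δ, φ (a + b - δ - b) = φ (δ - a) := fun δ => by
    rw [← aux_even hφ]; congr 1; ring
  have e2 : ∀ δ, φ (a + b - δ - a) = φ (δ - b) := fun δ => by
    rw [← aux_even hφ]; congr 1; ring
  have i1 : Integrable (fun δ => auxH g (a + b - δ) * φ (δ - a)) := by
    have := (hint b).comp_sub_left (a + b)
    simpa only [e1] using this
  have i2 : Integrable (fun δ => auxH g (a + b - δ) * φ (δ - b)) := by
    have := (hint a).comp_sub_left (a + b)
    simpa only [e2] using this
  have j1 : ∫ δ, auxH g (a + b - δ) * φ (δ - a) = ∫ δ, auxH g δ * φ (δ - b) := by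
    have := integral_sub_left_eq_self (fun δ => auxH g δ * φ (δ - b)) volume (a + b)
    simpa only [e1] using this
  have j2 : ∫ δ, auxH g (a + b - δ) * φ (δ - b) = ∫ δ, auxH g δ * φ (δ - a) := by
    have := integral_sub_left_eq_self (fun δ => auxH g δ * φ (δ - a)) volume (a + b)
    simpa only [e2] using this
  set F : ℝ → ℝ := fun δ => (auxH g δ * φ (δ - a) - auxH g δ * φ (δ - b)) -
    (auxH g (a + b - δ) * φ (δ - a) - auxH g (a + b - δ) * φ (δ - b)) with hF
  have hFi : Integrable F := ((hint a).sub (hint b)).sub (i1.sub i2)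
  have hFe : ∀ δ, F δ = (auxH g δ - auxH g (a + b - δ)) * (φ (δ - a) - φ (δ - b)) := by
    intro δ; simp only [hF]; ring
  have hFint : ∫ δ, F δ = 2 * ((∫ δ, auxH g δ * φ (δ - a)) - ∫ δ, auxH g δ * φ (δ - b)) := by
    have t1 := integral_sub ((hint a).sub (hint b)) (i1.sub i2)
    have t2 := integral_sub (hint a) (hint b)
    have t3 := integral_sub i1 i2
    simp only [Pi.sub_apply] at t1
    simp only [hF]
    rw [t1, t2, t3, j1, j2]; ring
  have hH : ∀ δ, (a + b) / 2 < δ → auxH g (a + b - δ) < auxH g δ := by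
    intro δ h
    apply auxH_lt hg
    rw [abs_lt, abs_of_pos (by linarith)]
    constructor <;> linarith
  have hH' : ∀ δ, δ < (a + b) / 2 → auxH g δ < auxH g (a + b - δ) := by
    intro δ h
    have := hH (a + b - δ) (by linarith)
    simpa using this
  have hP : ∀ δ, (a + b) / 2 < δ → φ (δ - b) ≤ φ (δ - a) := by
    intro δ h
    apply aux_mono hφ
    rw [abs_le, abs_of_pos (by linarith : 0 < δ - b)]
    constructor <;> linarith
  have hP' : ∀ δ, δ < (a + b) / 2 → φ (δ - a) ≤ φ (δ - b) := by
    intro δ h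
    have := hP (a + b - δ) (by linarith)
    rwa [e1, e2] at this
  have hF0 : 0 ≤ F := by
    intro δ
    simp only [Pi.zero_apply]
    rw [hFe]
    rcases lt_trichotomy δ ((a + b) / 2) with h | h | h
    · exact mul_nonneg_of_nonpos_of_nonpos (by linarith [hH' δ h]) (by linarith [hP' δ h])
    · have : a + b - δ = δ := by linarith
      rw [this]; simp
    · exact mul_nonneg (by linarith [hH δ h]) (by linarith [hP δ h])
  have hge : 0 ≤ ∫ δ, F δ := integral_nonneg hF0
  rcases hge.lt_or_eq with h | h
  · rw [hFint] at h; linarith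
  exfalso
  have hz := (integral_eq_zero_iff_of_nonneg hF0 hFi).1 h.symm
  have hz2 : ∀ᵐ δ : ℝ, φ (δ - a) = φ (δ - b) := by
    filter_upwards [hz, compl_mem_ae_iff.2 (measure_singleton ((a + b) / 2))] with δ h0 hne
    have hne : δ ≠ (a + b) / 2 := by simpa using hne
    simp only [Pi.zero_apply] at h0
    rw [hFe] at h0
    rcases mul_eq_zero.1 h0 with h | h
    · rcases lt_or_gt_of_ne hne with h' | h'
      · linarith [hH' δ h']
      · linarith [hH δ h']
    · linarith
  apply aux_nonper hφ (sub_pos.2 hab)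
  have := (measurePreserving_add_right volume a).quasiMeasurePreserving.ae hz2
  filter_upwards [this] with x hx
  rw [show x + a - a = x by ring, show x + a - b = x + (a - b) by ring] at hx
  exact hx.symm

/-- The discontinuity-gap term `U(μ) = E[Δ_i ∫_{-Δ_i}^0 g]` is even, minimized at
`μ = 0`, and strictly increasing in `|μ|`. (Lemma 2.) -/
theorem gap_term_minimized_at_zero
    (φ g : ℝ → ℝ) (hφ : SymmUnimodal φ 0) (hg : SymmUnimodal g 0)
    (U : ℝ → ℝ)
    (hU : ∀ μ, U μ = ∫ δ : ℝ, δ * φ (δ - μ) * (∫ s in (-δ)..(0 : ℝ), g s))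
    (hint : ∀ μ, Integrable (fun δ : ℝ =>
      δ * φ (δ - μ) * (∫ s in (-δ)..(0 : ℝ), g s))) :
    (∀ μ, U (-μ) = U μ) ∧
    (∀ μ, U 0 ≤ U μ) ∧
    (∀ μ₁ μ₂ : ℝ, 0 ≤ μ₂ → μ₂ < μ₁ → U μ₂ < U μ₁) := by
  have hfun : ∀ μ, (fun δ : ℝ => δ * φ (δ - μ) * (∫ s in (-δ)..(0 : ℝ), g s)) =
      fun δ => auxH g δ * φ (δ - μ) := by
    intro μ; funext δ; unfold auxH; ring
  have hU' : ∀ μ, U μ = ∫ δ, auxH g δ * φ (δ - μ) := by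
    intro μ; rw [hU, hfun]
  have hint' : ∀ μ, Integrable (fun δ : ℝ => auxH g δ * φ (δ - μ)) := by
    intro μ; rw [← hfun]; exact hint μ
  have p1 : ∀ μ, U (-μ) = U μ := by
    intro μ
    rw [hU', hU', ← integral_neg_eq_self]
    congr 1; funext δ
    rw [auxH_even hg, ← aux_even hφ]; congr 2; ring
  have p3 : ∀ μ₁ μ₂ : ℝ, 0 ≤ μ₂ → μ₂ < μ₁ → U μ₂ < U μ₁ := by
    intro a b hb hab
    rw [hU', hU']
    exact aux_strict φ g hφ hg hint' a b hb hab
  refine ⟨p1, ?_, p3⟩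
  intro μ
  rcases lt_trichotomy μ 0 with h | h | h
  · rw [← p1 μ]; exact (p3 (-μ) 0 le_rfl (by linarith)).le
  · rw [h]
  · exact (p3 μ 0 le_rfl h).le
end

section
/- Let φ and g be probability densities on ℝ, each symmetric unimodal about 0, let m > 0, and define U(μ) := ∫_ℝ δ·φ(δ − μ)·( ∫_{0}^{δ + m} g(s) ds ) dδ, where ∫_{0}^{δ+m} denotes the signed integral. Then U(μ) ≥ U(0) for every μ > 0, and U(μ) ≥ U(−m) for every μ < −m. (Hence, against an aggregate opponents' deviation m > 0, no strategy μ_i ≥ 0 or μ_i ≤ −m can be a strictly better response than 0 or −m respectively.) -/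
open MeasureTheory intervalIntegral

/-- Shifting a symmetric unimodal weight `φ` to the right increases `∫ k φ(· - μ)` whenever
`k y ≤ k x` for all `y ≤ x` with `x + y > 0` (reflection about `μ / 2`). -/
theorem shift_ineq (φ k : ℝ → ℝ) (hφe : ∀ x, φ (-x) = φ x)
    (hφu : ∀ x y, |y - 0| ≤ |x - 0| → φ x ≤ φ y)
    (key : ∀ x y, 0 < x + y → y ≤ x → k y ≤ k x)
    (hint : ∀ μ, Integrable (fun x : ℝ => k x * φ (x - μ))) (μ : ℝ) (hμ : 0 < μ) :
    ∫ x, k x * φ (x - 0) ≤ ∫ x, k x * φ (x - μ) := by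
  have i1 := hint μ
  have i0 := hint 0
  have i1' := i1.comp_sub_left μ
  have i0' := i0.comp_sub_left μ
  have e1 := integral_sub_left_eq_self (fun x : ℝ => k x * φ (x - μ)) volume μ
  have e0 := integral_sub_left_eq_self (fun x : ℝ => k x * φ (x - 0)) volume μ
  have hs := integral_sub (i1.add i1') (i0.add i0')
  have ha := integral_add i1 i1'
  have hb := integral_add i0 i0'
  simp only [Pi.add_apply] at hs
  rw [ha, hb, e1, e0] at hs
  have hn : 0 ≤ (∫ x, k x * φ (x - μ)) + (∫ x, k x * φ (x - μ))
      - ((∫ x, k x * φ (x - 0)) + (∫ x, k x * φ (x - 0))) := by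
    rw [← hs]
    apply MeasureTheory.integral_nonneg
    intro x
    have p1 : φ (μ - x - μ) = φ x := by rw [← hφe x]; congr 1; ring
    have p2 : φ (μ - x - 0) = φ (x - μ) := by rw [← hφe (x - μ)]; congr 1; ring
    simp only [Pi.zero_apply, p1, p2]
    simp only [sub_zero]
    have hprod : 0 ≤ (k x - k (μ - x)) * (φ (x - μ) - φ x) := by
      rcases le_total (μ - x) x with h | h
      · apply mul_nonneg
        · linarith [key x (μ - x) (by linarith) h]
        · have : φ x ≤ φ (x - μ) := by
            apply hφu
            rw [sub_zero, sub_zero, ← sq_le_sq]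
            nlinarith
          linarith
      · apply mul_nonneg_of_nonpos_of_nonpos
        · linarith [key (μ - x) x (by linarith) h]
        · have : φ (x - μ) ≤ φ x := by
            apply hφu
            rw [sub_zero, sub_zero, ← sq_le_sq]
            nlinarith
          linarith
    linarith
  linarith

/-- Against an aggregate opponents' deviation `m > 0`, the gap term
`U(μ) = E[Δ_i ∫_0^{Δ_i+m} g]` satisfies `U(μ) ≥ U(0)` for `μ > 0` and
`U(μ) ≥ U(-m)` for `μ < -m`. (Key claims in the proof of Theorem 2.) -/
theorem gap_term_best_response_bounds
    (φ g : ℝ → ℝ) (hφ : SymmUnimodal φ 0) (hg : SymmUnimodal g 0)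
    (m : ℝ) (hm : 0 < m)
    (U : ℝ → ℝ)
    (hU : ∀ μ, U μ = ∫ δ : ℝ, δ * φ (δ - μ) * (∫ s in (0 : ℝ)..(δ + m), g s))
    (hint : ∀ μ, Integrable (fun δ : ℝ =>
      δ * φ (δ - μ) * (∫ s in (0 : ℝ)..(δ + m), g s))) :
    (∀ μ, 0 < μ → U 0 ≤ U μ) ∧
    (∀ μ, μ < -m → U (-m) ≤ U μ) := by
  obtain ⟨⟨-, -, -⟩, hφs, hφu⟩ := hφ
  obtain ⟨⟨-, hg0, hg1⟩, hgs, -⟩ := hg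
  have hgi : Integrable g := by
    by_contra h
    rw [integral_undef h] at hg1
    exact zero_ne_one hg1
  have hgii : ∀ a b : ℝ, IntervalIntegrable g volume a b := fun a b => hgi.intervalIntegrable
  have hφe : ∀ x, φ (-x) = φ x := fun x => by
    have := hφs x
    simp only [zero_add, zero_sub] at this
    exact this.symm
  have hge : ∀ x, g (-x) = g x := fun x => by
    have := hgs x
    simp only [zero_add, zero_sub] at this
    exact this.symm
  obtain ⟨G, hG⟩ : ∃ G : ℝ → ℝ, ∀ x, G x = ∫ s in (0 : ℝ)..x, g s := ⟨_, fun _ => rfl⟩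
  simp only [← hG] at hU hint
  have hodd : ∀ x, G (-x) = - G x := fun x => by
    have h1 := intervalIntegral.integral_comp_neg (f := g) (a := 0) (b := x)
    simp only [hge, neg_zero] at h1
    rw [hG, hG, h1, intervalIntegral.integral_symm]
  have hmono : ∀ x y, x ≤ y → G x ≤ G y := fun x y hxy => by
    have h1 := intervalIntegral.integral_add_adjacent_intervals (hgii 0 x) (hgii x y)
    have h2 : 0 ≤ ∫ s in x..y, g s :=
      intervalIntegral.integral_nonneg hxy (fun u _ => hg0 u)
    rw [hG, hG]
    linarith
  have hpos : ∀ x, 0 ≤ x → 0 ≤ G x := fun x hx => by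
    have h1 := hmono (-x) x (by linarith)
    rw [hodd] at h1
    linarith
  have key : ∀ x y, 0 < x + y → y ≤ x → y * G (y + m) ≤ x * G (x + m) := by
    intro x y h1 h2
    have hx : 0 < x := by linarith
    have hGx := hpos (x + m) (by linarith)
    rcases le_total 0 y with hy | hy
    · exact mul_le_mul h2 (hmono _ _ (by linarith)) (hpos _ (by linarith)) hx.le
    · have h3 : G (-(y + m)) ≤ G (x + m) := hmono _ _ (by linarith)
      have h4 : y * G (y + m) = (-y) * G (-(y + m)) := by rw [hodd]; ring
      rw [h4]
      calc (-y) * G (-(y + m)) ≤ (-y) * G (x + m) :=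
            mul_le_mul_of_nonneg_left h3 (by linarith)
        _ ≤ x * G (x + m) := mul_le_mul_of_nonneg_right (by linarith) hGx
  have key2 : ∀ x y, 0 < x + y → y ≤ x → (y + m) * G y ≤ (x + m) * G x := by
    intro x y h1 h2
    have hx : 0 < x := by linarith
    have hGx := hpos x hx.le
    rcases le_total 0 y with hy | hy
    · exact mul_le_mul (by linarith) (hmono _ _ h2) (hpos _ hy) (by linarith)
    · have hGy := hpos (-y) (by linarith)
      have h3 : G (-y) ≤ G x := hmono _ _ (by linarith)
      have h4 : (y + m) * G y = (-y - m) * G (-y) := by rw [hodd]; ring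
      rw [h4]
      calc (-y - m) * G (-y) ≤ (x + m) * G (-y) :=
            mul_le_mul_of_nonneg_right (by linarith) hGy
        _ ≤ (x + m) * G x := mul_le_mul_of_nonneg_left h3 (by linarith)
  have er : ∀ ν y, (-m - y) * φ (-m - y - (-m - ν)) * G (-m - y + m)
      = ((y + m) * G y) * φ (y - ν) := by
    intro ν y
    have p1 : φ (-m - y - (-m - ν)) = φ (y - ν) := by rw [← hφe (y - ν)]; congr 1; ring
    have p2 : G (-m - y + m) = - G y := by rw [← hodd]; congr 1; ring
    rw [p1, p2]
    ring
  have hV : ∀ ν, U (-m - ν) = ∫ y, ((y + m) * G y) * φ (y - ν) := by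
    intro ν
    rw [hU, ← integral_sub_left_eq_self
      (fun δ : ℝ => δ * φ (δ - (-m - ν)) * G (δ + m)) volume (-m)]
    simp only [er]
  have hVint : ∀ ν, Integrable (fun y => ((y + m) * G y) * φ (y - ν)) := by
    intro ν
    have h := (hint (-m - ν)).comp_sub_left (-m)
    simpa only [er] using h
  have e1 : ∀ μ δ, δ * φ (δ - μ) * G (δ + m) = (δ * G (δ + m)) * φ (δ - μ) :=
    fun μ δ => by ring
  simp only [e1] at hU hint
  constructor
  · intro μ hμ
    rw [hU, hU]
    exact shift_ineq φ (fun x => x * G (x + m)) hφe hφu key hint μ hμ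
  · intro μ hμ
    have h := shift_ineq φ (fun x => (x + m) * G x) hφe hφu key2 hVint (-m - μ) (by linarith)
    simp only [← hV] at h
    simpa using h
end

section
/- Consider N ≥ 2 utilities. Utility i has demand D_i > 0 and prediction-error density φ_i symmetric unimodal about 0 with finite variance σ_i². Given a strategy profile μ ∈ ℝ^N, utility i's mismatch Δ_i has density δ ↦ φ_i(δ − μ_i), the mismatches are independent, and utility i's cost is C_i(μ) = E[ p_d + Δ_i·(p_s(Δ₁+⋯+Δ_N) − p_d)/D_i ], where p_s is the piecewise-linear symmetric spot pricing with day-ahead price p_d > 0, parameters a₁ = a₂ > 0, b₁ + b₂ = 2, b₁ > b₂ > 0. Then the all-zero profile μ* = (0,…,0) is a pure strategy Nash equilibrium, and it is the unique one: every profile μ satisfying C_i(μ_i, μ_{−i}) ≤ C_i(ν, μ_{−i}) for all i and all ν ∈ ℝ has μ_i = 0 for every i. -/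
open MeasureTheory

/-- Piecewise-linear spot pricing with day-ahead price `pd`. -/
noncomputable def spotPrice (a₁ a₂ b₁ b₂ pd : ℝ) (Δ : ℝ) : ℝ :=
  if 0 < Δ then (a₁ * Δ + b₁) * pd
  else if Δ < 0 then (a₂ * Δ + b₂) * pd
  else pd

/-- Expected cost of utility `i` under strategy profile `μ`: the mismatches are
independent with densities `δ ↦ φ j (δ - μ j)`. -/
noncomputable def cost {N : ℕ} (φ : Fin N → ℝ → ℝ) (D : Fin N → ℝ)
    (ps : ℝ → ℝ) (pd : ℝ) (i : Fin N) (μ : Fin N → ℝ) : ℝ :=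
  ∫ δ : Fin N → ℝ,
    (pd + δ i * (ps (∑ j, δ j) - pd) / D i) * ∏ j, φ j (δ j - μ j)


/-- The sign function used throughout. -/
noncomputable def sg (x : ℝ) : ℝ := if 0 < x then 1 else if x < 0 then -1 else 0

lemma sg_meas : Measurable sg :=
  Measurable.ite measurableSet_Ioi measurable_const
    (Measurable.ite measurableSet_Iio measurable_const measurable_const)

lemma sg_neg (x : ℝ) : sg (-x) = - sg x := by
  unfold sg; split_ifs <;> first | linarith | norm_num

lemma sg_abs (x : ℝ) : |sg x| ≤ 1 := by
  unfold sg; split_ifs <;> norm_num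

lemma sg_mono {x y : ℝ} (h : x ≤ y) : sg x ≤ sg y := by
  unfold sg; split_ifs <;> first | linarith | norm_num

lemma mul_sg (x : ℝ) : x * sg x = |x| := by
  unfold sg
  split_ifs with h1 h2
  · rw [abs_of_pos h1]; ring
  · rw [abs_of_neg h2]; ring
  · have : x = 0 := by linarith
    simp [this]

lemma mul_sg_le (x y : ℝ) : x * sg y ≤ |x| := by
  calc x * sg y ≤ |x * sg y| := le_abs_self _
    _ = |x| * |sg y| := abs_mul _ _
    _ ≤ |x| * 1 := by gcongr; exact sg_abs y
    _ = |x| := mul_one _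

lemma spot_eq (a b₁ b₂ pd x : ℝ) (hb : b₁ + b₂ = 2) :
    spotPrice a a b₁ b₂ pd x - pd = pd * (a * x + (b₁ - b₂) / 2 * sg x) := by
  have : b₂ = 2 - b₁ := by linarith
  subst this
  unfold spotPrice sg
  split_ifs with h1 h2
  · ring
  · ring
  · have : x = 0 := by linarith
    subst this; ring

section weighted

variable {N : ℕ}

/-- Product weight. -/
noncomputable def wt (φ : Fin N → ℝ → ℝ) (x : Fin N → ℝ) : ℝ := ∏ j, φ j (x j)

lemma wt_meas {φ : Fin N → ℝ → ℝ} (hφ : ∀ i, SymmUnimodal (φ i) 0) : Measurable (wt φ) := by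
  unfold wt
  exact Finset.measurable_prod _ fun j _ => (hφ j).1.1.comp (measurable_pi_apply j)

lemma wt_nonneg {φ : Fin N → ℝ → ℝ} (hφ : ∀ i, SymmUnimodal (φ i) 0) (x) : 0 ≤ wt φ x :=
  Finset.prod_nonneg fun j _ => (hφ j).1.2.1 _

lemma phi_neg {f : ℝ → ℝ} (h : SymmUnimodal f 0) (x : ℝ) : f (-x) = f x := by
  have := h.2.1 x; simpa using this.symm

lemma wt_neg {φ : Fin N → ℝ → ℝ} (hφ : ∀ i, SymmUnimodal (φ i) 0) (x) : wt φ (-x) = wt φ x :=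
  Finset.prod_congr rfl fun j _ => phi_neg (hφ j) _

lemma phi_int {f : ℝ → ℝ} (h : SymmUnimodal f 0) : Integrable f := by
  by_contra h'
  have := h.1.2.2
  rw [integral_undef h'] at this
  norm_num at this

lemma wt_int {φ : Fin N → ℝ → ℝ} (hφ : ∀ i, SymmUnimodal (φ i) 0) : Integrable (wt φ) :=
  Integrable.fintype_prod fun j => phi_int (hφ j)

lemma wt_one {φ : Fin N → ℝ → ℝ} (hφ : ∀ i, SymmUnimodal (φ i) 0) : ∫ x, wt φ x = 1 := by
  unfold wt
  rw [integral_fintype_prod_volume_eq_prod]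
  exact Finset.prod_eq_one fun j _ => (hφ j).1.2.2

lemma sq_int {φ : Fin N → ℝ → ℝ} (hφ : ∀ i, SymmUnimodal (φ i) 0)
    (hmom : ∀ i, Integrable (fun x => x ^ 2 * φ i x)) (i : Fin N) :
    Integrable fun x => (x i) ^ 2 * wt φ x := by
  have h : Integrable (fun x : Fin N → ℝ =>
      ∏ j, (if j = i then (fun t => t ^ 2 * φ j t) else φ j) (x j)) := by
    refine Integrable.fintype_prod (f := fun j => if j = i then (fun t => t ^ 2 * φ j t) else φ j)
      fun j => ?_
    dsimp only
    split_ifs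
    · exact hmom j
    · exact phi_int (hφ j)
  convert h using 2 with x
  unfold wt
  rw [← Finset.mul_prod_erase _ _ (Finset.mem_univ i),
    ← Finset.mul_prod_erase _ _ (Finset.mem_univ i)]
  simp only [if_true]
  rw [mul_assoc]
  congr 2
  refine Finset.prod_congr rfl fun j hj => ?_
  rw [if_neg (Finset.ne_of_mem_erase hj)]

lemma gen_int {φ : Fin N → ℝ → ℝ} (hφ : ∀ i, SymmUnimodal (φ i) 0)
    (hmom : ∀ i, Integrable (fun x => x ^ 2 * φ i x)) {f : (Fin N → ℝ) → ℝ} (hf : Measurable f)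
    (C : ℝ) (hC : ∀ x, |f x| ≤ C * (1 + ∑ j, (x j) ^ 2)) :
    Integrable fun x => f x * wt φ x := by
  have h : Integrable fun x : Fin N → ℝ => C * (1 + ∑ j, (x j) ^ 2) * wt φ x := by
    have h1 : Integrable fun x : Fin N → ℝ => ∑ j, (x j) ^ 2 * wt φ x :=
      integrable_finsetSum _ fun j _ => sq_int hφ hmom j
    have h2 := ((wt_int hφ).add h1).const_mul C
    convert h2 using 2 with x
    simp only [Pi.add_apply, ← Finset.sum_mul]
    ring
  refine h.mono' (hf.mul (wt_meas hφ)).aestronglyMeasurable (Filter.Eventually.of_forall fun x => ?_)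
  rw [Real.norm_eq_abs, abs_mul, abs_of_nonneg (wt_nonneg hφ x)]
  exact mul_le_mul_of_nonneg_right (hC x) (wt_nonneg hφ x)

lemma sq_le_sum (x : Fin N → ℝ) (i : Fin N) : (x i) ^ 2 ≤ ∑ j, (x j) ^ 2 :=
  Finset.single_le_sum (f := fun j => (x j) ^ 2) (fun j _ => sq_nonneg _) (Finset.mem_univ i)

lemma int_sg {φ : Fin N → ℝ → ℝ} (hφ : ∀ i, SymmUnimodal (φ i) 0)
    (hmom : ∀ i, Integrable (fun x => x ^ 2 * φ i x)) (M : ℝ) :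
    Integrable fun x => sg ((∑ j, x j) + M) * wt φ x := by
  refine gen_int hφ hmom (sg_meas.comp (by fun_prop)) 1 fun x => ?_
  have := sg_abs ((∑ j, x j) + M)
  have : 0 ≤ ∑ j, (x j) ^ 2 := Finset.sum_nonneg fun j _ => sq_nonneg _
  linarith

lemma int_x {φ : Fin N → ℝ → ℝ} (hφ : ∀ i, SymmUnimodal (φ i) 0)
    (hmom : ∀ i, Integrable (fun x => x ^ 2 * φ i x)) (i : Fin N) :
    Integrable fun x => x i * wt φ x := by
  refine gen_int hφ hmom (by fun_prop) 1 fun x => ?_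
  have := sq_le_sum x i
  rw [abs_le]
  constructor <;> nlinarith [sq_nonneg (x i - 1), sq_nonneg (x i + 1)]

lemma int_xsg {φ : Fin N → ℝ → ℝ} (hφ : ∀ i, SymmUnimodal (φ i) 0)
    (hmom : ∀ i, Integrable (fun x => x ^ 2 * φ i x)) (i : Fin N) {s : (Fin N → ℝ) → ℝ}
    (hs : Measurable s) (hs1 : ∀ x, |s x| ≤ 1) :
    Integrable fun x => x i * s x * wt φ x := by
  refine gen_int hφ hmom ((measurable_pi_apply i).mul hs) 1 fun x => ?_
  have := sq_le_sum x i
  rw [abs_mul]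
  have h : |x i| * |s x| ≤ |x i| := mul_le_of_le_one_right (abs_nonneg _) (hs1 x)
  nlinarith [sq_nonneg (|x i| - 1), sq_abs (x i)]

lemma int_xx {φ : Fin N → ℝ → ℝ} (hφ : ∀ i, SymmUnimodal (φ i) 0)
    (hmom : ∀ i, Integrable (fun x => x ^ 2 * φ i x)) (i : Fin N) :
    Integrable fun x => x i * (∑ j, x j) * wt φ x := by
  have : Integrable fun x : Fin N → ℝ => ∑ j, x i * x j * wt φ x := by
    refine integrable_finsetSum _ fun j _ => gen_int hφ hmom (by fun_prop) 1 fun x => ?_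
    have h1 := sq_le_sum x i
    have h2 := sq_le_sum x j
    rw [abs_le]
    constructor <;> nlinarith [sq_nonneg (x i - x j), sq_nonneg (x i + x j)]
  convert this using 2 with x
  rw [Finset.mul_sum, Finset.sum_mul]

/-- `E[sign(Z+M)]`. -/
noncomputable def GG (φ : Fin N → ℝ → ℝ) (M : ℝ) : ℝ := ∫ x, sg ((∑ j, x j) + M) * wt φ x
/-- `E[X_i sign(Z+M)]`. -/
noncomputable def HH (φ : Fin N → ℝ → ℝ) (i : Fin N) (M : ℝ) : ℝ :=
  ∫ x, x i * sg ((∑ j, x j) + M) * wt φ x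
/-- `E[X_i Z]`. -/
noncomputable def VV (φ : Fin N → ℝ → ℝ) (i : Fin N) : ℝ :=
  ∫ x, x i * (∑ j, x j) * wt φ x

lemma int_H {φ : Fin N → ℝ → ℝ} (hφ : ∀ i, SymmUnimodal (φ i) 0)
    (hmom : ∀ i, Integrable (fun x => x ^ 2 * φ i x)) (i : Fin N) (M : ℝ) :
    Integrable fun x => x i * sg ((∑ j, x j) + M) * wt φ x :=
  int_xsg hφ hmom i (s := fun x => sg ((∑ j, x j) + M)) (sg_meas.comp (by fun_prop))
    fun x => sg_abs _

lemma E_x {φ : Fin N → ℝ → ℝ} (hφ : ∀ i, SymmUnimodal (φ i) 0) (i : Fin N) :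
    ∫ x, x i * wt φ x = 0 := by
  have h := integral_neg_eq_self (fun x : Fin N → ℝ => x i * wt φ x) volume
  simp only [wt_neg hφ, Pi.neg_apply, neg_mul, integral_neg] at h
  linarith

lemma GG_neg {φ : Fin N → ℝ → ℝ} (hφ : ∀ i, SymmUnimodal (φ i) 0) (M : ℝ) :
    GG φ (-M) = - GG φ M := by
  unfold GG
  rw [← integral_neg, ← integral_neg_eq_self]
  congr 1; ext x
  rw [wt_neg hφ, ← neg_mul, ← sg_neg]
  simp only [Pi.neg_apply, Finset.sum_neg_distrib]
  congr 2; ring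

lemma HH_neg {φ : Fin N → ℝ → ℝ} (hφ : ∀ i, SymmUnimodal (φ i) 0) (i : Fin N) (M : ℝ) :
    HH φ i (-M) = HH φ i M := by
  unfold HH
  rw [← integral_neg_eq_self]
  congr 1; ext x
  rw [wt_neg hφ]
  simp only [Pi.neg_apply, Finset.sum_neg_distrib]
  rw [show -∑ j, x j + -M = -(∑ j, x j + M) by ring, sg_neg]
  ring

lemma GG_zero {φ : Fin N → ℝ → ℝ} (hφ : ∀ i, SymmUnimodal (φ i) 0) : GG φ 0 = 0 := by
  have := GG_neg hφ 0
  rw [neg_zero] at this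
  linarith

lemma GG_nonneg {φ : Fin N → ℝ → ℝ} (hφ : ∀ i, SymmUnimodal (φ i) 0)
    (hmom : ∀ i, Integrable (fun x => x ^ 2 * φ i x)) {t : ℝ} (ht : 0 ≤ t) : 0 ≤ GG φ t := by
  rw [← GG_zero hφ]
  exact integral_mono (int_sg hφ hmom 0) (int_sg hφ hmom t) fun x =>
    mul_le_mul_of_nonneg_right (sg_mono (by linarith)) (wt_nonneg hφ x)

lemma sum_HH {φ : Fin N → ℝ → ℝ} (hφ : ∀ i, SymmUnimodal (φ i) 0)
    (hmom : ∀ i, Integrable (fun x => x ^ 2 * φ i x)) (M : ℝ) :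
    ∑ i, HH φ i M = ∫ x, (∑ j, x j) * sg ((∑ j, x j) + M) * wt φ x := by
  unfold HH
  rw [← integral_finsetSum _ fun i _ => int_H hφ hmom i M]
  congr 1; ext x
  rw [Finset.sum_mul, Finset.sum_mul]

lemma int_K {φ : Fin N → ℝ → ℝ} (hφ : ∀ i, SymmUnimodal (φ i) 0)
    (hmom : ∀ i, Integrable (fun x => x ^ 2 * φ i x)) (M : ℝ) :
    Integrable fun x => (∑ j, x j) * sg ((∑ j, x j) + M) * wt φ x := by
  have := integrable_finsetSum Finset.univ fun i _ => int_H hφ hmom i M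
  refine this.congr (Filter.Eventually.of_forall fun x => ?_)
  dsimp only
  rw [Finset.sum_mul, Finset.sum_mul]

lemma K_le {φ : Fin N → ℝ → ℝ} (hφ : ∀ i, SymmUnimodal (φ i) 0)
    (hmom : ∀ i, Integrable (fun x => x ^ 2 * φ i x)) (M : ℝ) :
    ∑ i, HH φ i M ≤ ∑ i, HH φ i 0 := by
  rw [sum_HH hφ hmom, sum_HH hφ hmom]
  refine integral_mono (int_K hφ hmom M) (int_K hφ hmom 0) fun x =>
    mul_le_mul_of_nonneg_right ?_ (wt_nonneg hφ x)
  rw [add_zero, mul_sg]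
  exact mul_sg_le _ _

lemma A_ge {φ : Fin N → ℝ → ℝ} (hφ : ∀ i, SymmUnimodal (φ i) 0)
    (hmom : ∀ i, Integrable (fun x => x ^ 2 * φ i x)) (M : ℝ) :
    ∑ i, HH φ i 0 ≤ M * GG φ M + ∑ i, HH φ i M := by
  have e : ∑ i, HH φ i 0 = M * GG φ 0 + ∑ i, HH φ i 0 := by rw [GG_zero hφ]; ring
  rw [e, sum_HH hφ hmom, sum_HH hφ hmom]
  unfold GG
  rw [← integral_const_mul, ← integral_const_mul,
    ← integral_add ((int_sg hφ hmom 0).const_mul M) (int_K hφ hmom 0),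
    ← integral_add ((int_sg hφ hmom M).const_mul M) (int_K hφ hmom M)]
  refine integral_mono (((int_sg hφ hmom 0).const_mul M).add (int_K hφ hmom 0))
    (((int_sg hφ hmom M).const_mul M).add (int_K hφ hmom M)) fun x => ?_
  have h1 := mul_sg (∑ j, x j + M)
  have h2 := mul_sg_le (∑ j, x j + M) (∑ j, x j + 0)
  have h3 := mul_le_mul_of_nonneg_right (h2.trans_eq h1.symm) (wt_nonneg hφ x)
  dsimp only
  linarith

lemma cost_eq {φ : Fin N → ℝ → ℝ} (hφ : ∀ i, SymmUnimodal (φ i) 0)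
    (hmom : ∀ i, Integrable (fun x => x ^ 2 * φ i x)) (D : Fin N → ℝ) (pd a b₁ b₂ : ℝ)
    (hb : b₁ + b₂ = 2) (i : Fin N) (μ : Fin N → ℝ) :
    cost φ D (spotPrice a a b₁ b₂ pd) pd i μ = pd + pd / D i *
      (a * (VV φ i + μ i * ∑ j, μ j) +
        (b₁ - b₂) / 2 * (μ i * GG φ (∑ j, μ j) + HH φ i (∑ j, μ j))) := by
  unfold cost
  rw [← integral_add_right_eq_self _ μ]
  set M := ∑ j, μ j with hM
  have hZ : Integrable fun x : Fin N → ℝ => (∑ j, x j) * wt φ x := by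
    have := integrable_finsetSum Finset.univ fun i _ => int_x hφ hmom i
    refine this.congr (Filter.Eventually.of_forall fun x => ?_)
    dsimp only
    rw [Finset.sum_mul]
  have hZ0 : ∫ x : Fin N → ℝ, (∑ j, x j) * wt φ x = 0 := by
    simp_rw [Finset.sum_mul]
    rw [integral_finsetSum _ fun i _ => int_x hφ hmom i]
    exact Finset.sum_eq_zero fun j _ => E_x hφ j
  have e : ∀ x : Fin N → ℝ, (pd + (x + μ) i * (spotPrice a a b₁ b₂ pd (∑ j, (x + μ) j) - pd) / D i)
        * ∏ j, φ j ((x + μ) j - μ j) =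
      (pd + pd / D i * (a * (μ i * M))) * wt φ x + (pd / D i * a * M) * (x i * wt φ x)
      + (pd / D i * a * μ i) * ((∑ j, x j) * wt φ x)
      + (pd / D i * a) * (x i * (∑ j, x j) * wt φ x)
      + (pd / D i * ((b₁ - b₂) / 2) * μ i) * (sg ((∑ j, x j) + M) * wt φ x)
      + (pd / D i * ((b₁ - b₂) / 2)) * (x i * sg ((∑ j, x j) + M) * wt φ x) := by
    intro x
    rw [spot_eq _ _ _ _ _ hb]
    simp only [Pi.add_apply, add_sub_cancel_right, Finset.sum_add_distrib, ← hM]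
    rw [show ∏ j, φ j (x j) = wt φ x from rfl]
    ring
  simp_rw [e]
  have i1 := (wt_int hφ).const_mul (pd + pd / D i * (a * (μ i * M)))
  have i2 := (int_x hφ hmom i).const_mul (pd / D i * a * M)
  have i3 := hZ.const_mul (pd / D i * a * μ i)
  have i4 := (int_xx hφ hmom i).const_mul (pd / D i * a)
  have i5 := (int_sg hφ hmom M).const_mul (pd / D i * ((b₁ - b₂) / 2) * μ i)
  have i6 := (int_H hφ hmom i M).const_mul (pd / D i * ((b₁ - b₂) / 2))
  rw [integral_add ((((i1.fun_add i2).fun_add i3).fun_add i4).fun_add i5) i6,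
    integral_add (((i1.fun_add i2).fun_add i3).fun_add i4) i5,
    integral_add ((i1.fun_add i2).fun_add i3) i4,
    integral_add (i1.fun_add i2) i3, integral_add i1 i2]
  simp only [integral_const_mul, wt_one hφ, E_x hφ, hZ0]
  unfold GG HH VV
  ring

lemma pair_mono (y : ℝ) {u v : ℝ} (h : |u| ≤ |v|) :
    u * (sg (u + y) + sg (u - y)) ≤ v * (sg (v + y) + sg (v - y)) := by
  have key : ∀ u : ℝ, u * (sg (u + y) + sg (u - y)) =
      |u| * (sg (|u| + y) + sg (|u| - y)) := by
    intro u
    rcases abs_choice u with h | h <;> rw [h]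
    have h1 := sg_neg (u - y)
    have h2 := sg_neg (u + y)
    rw [show -u + y = -(u - y) by ring, show -u - y = -(u + y) by ring, h1, h2]; ring
  rw [key u, key v]
  have hu := abs_nonneg u
  have m1 := sg_mono (show |u| + y ≤ |v| + y by linarith)
  have m2 := sg_mono (show |u| - y ≤ |v| - y by linarith)
  have m3 : 0 ≤ sg (|u| + y) + sg (|u| - y) := by
    have := sg_mono (show -(|u| + y) ≤ |u| - y by linarith)
    rw [sg_neg] at this
    linarith
  exact mul_le_mul h (by linarith) m3 (abs_nonneg _)

lemma exist_ineq {φ : Fin N → ℝ → ℝ} (hφ : ∀ i, SymmUnimodal (φ i) 0)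
    (hmom : ∀ i, Integrable (fun x => x ^ 2 * φ i x)) (i : Fin N) (ν : ℝ) :
    HH φ i 0 ≤ ν * GG φ ν + HH φ i ν := by
  set e : Fin N → ℝ := Pi.single i ν with he
  have hes : ∑ j, e j = ν := by simp [he]
  have hei : e i = ν := by simp [he]
  set F : (Fin N → ℝ) → ℝ := fun x => x i * sg (∑ j, x j) with hF
  have hFw : Integrable fun x => F x * wt φ x := by
    have := int_H hφ hmom i 0
    simpa [hF] using this
  -- shifted integrals
  have hFs : Integrable fun x => (x i + ν) * sg (∑ j, x j + ν) * wt φ x := by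
    have := ((int_sg hφ hmom ν).const_mul ν).add (int_H hφ hmom i ν)
    refine this.congr (Filter.Eventually.of_forall fun x => ?_)
    simp only [Pi.add_apply]; ring
  have hFs' : (fun x => (x i + ν) * sg (∑ j, x j + ν) * wt φ x) =
      fun x => (fun z => F z * wt φ (z - e)) (x + e) := by
    ext x
    simp only [hF, Pi.add_apply, Finset.sum_add_distrib, hes, hei, add_sub_cancel_right]
  have hFe : Integrable fun x => F x * wt φ (x - e) := by
    have := hFs.comp_sub_right e
    refine this.congr (Filter.Eventually.of_forall fun x => ?_)
    have h := congrFun hFs' (x - e)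
    dsimp only at h
    rw [sub_add_cancel] at h
    exact h
  have hval : ν * GG φ ν + HH φ i ν = ∫ x, F x * wt φ (x - e) := by
    rw [← integral_add_right_eq_self _ e]
    have := congrFun hFs'
    simp only at this
    simp_rw [← this]
    unfold GG HH
    rw [← integral_const_mul, ← integral_add ((int_sg hφ hmom ν).const_mul ν) (int_H hφ hmom i ν)]
    congr 1; ext x; ring
  have hval0 : HH φ i 0 = ∫ x, F x * wt φ x := by simp [HH, hF]
  set d : (Fin N → ℝ) → ℝ := fun x => wt φ (x - e) - wt φ x with hd
  have hFd : Integrable fun x => F x * d x := by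
    have := hFe.sub hFw
    refine this.congr (Filter.Eventually.of_forall fun x => ?_)
    simp only [hd, Pi.sub_apply]; ring
  suffices h : 0 ≤ ∫ x, F x * d x by
    have h2 : ∫ x, F x * d x = (∫ x, F x * wt φ (x - e)) - ∫ x, F x * wt φ x := by
      rw [← integral_sub hFe hFw]
      congr 1; ext x; simp only [hd]; ring
    linarith
  -- the flip of all coordinates but `i`
  set R : (Fin N → ℝ) → (Fin N → ℝ) := fun x j => (if j = i then (id : ℝ → ℝ) else Neg.neg) (x j)
    with hR
  have hRmp : MeasurePreserving R := by
    refine volume_preserving_pi (f := fun j => if j = i then (id : ℝ → ℝ) else Neg.neg) fun j => ?_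
    split_ifs
    · exact MeasurePreserving.id _
    · exact Measure.measurePreserving_neg _
  have hRi : ∀ x, R x i = x i := fun x => by simp [hR]
  have hRj : ∀ x j, j ≠ i → R x j = - x j := fun x j hj => by simp [hR, hj]
  have hRR : ∀ x, R (R x) = x := by
    intro x; ext j
    by_cases hj : j = i
    · subst hj; rw [hRi, hRi]
    · rw [hRj _ _ hj, hRj _ _ hj, neg_neg]
  have hRe : MeasurableEmbedding R :=
    (MeasurableEquiv.mk ⟨R, R, hRR, hRR⟩ hRmp.measurable hRmp.measurable).measurableEmbedding
  have hwR : ∀ x, wt φ (R x) = wt φ x := by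
    intro x
    refine Finset.prod_congr rfl fun j _ => ?_
    by_cases hj : j = i
    · subst hj; rw [hRi]
    · rw [hRj _ _ hj, phi_neg (hφ j)]
  have hRsub : ∀ x, R x - e = R (x - e) := by
    intro x; ext j
    by_cases hj : j = i
    · subst hj; rw [hRi, Pi.sub_apply, Pi.sub_apply, hRi]
    · rw [hRj _ _ hj, Pi.sub_apply, Pi.sub_apply, hRj _ _ hj]
      simp [he, hj]
  have hdR : ∀ x, d (R x) = d x := by
    intro x; simp only [hd, hRsub, hwR]
  have hdT : ∀ x, d (e - x) = - d x := by
    intro x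
    simp only [hd]
    rw [show e - x - e = -x by abel, wt_neg hφ, ← neg_sub x e, wt_neg hφ]; ring
  have hRsum : ∀ x, ∑ j, R x j = x i - (∑ j, x j - x i) := by
    intro x
    rw [← Finset.add_sum_erase _ _ (Finset.mem_univ i),
      ← Finset.add_sum_erase _ x (Finset.mem_univ i), hRi,
      Finset.sum_congr rfl fun j hj => hRj x j (Finset.ne_of_mem_erase hj),
      Finset.sum_neg_distrib]
    ring
  set S : (Fin N → ℝ) → ℝ := fun x => F x + F (R x) with hS
  have hFRd : Integrable fun x => F (R x) * d x := by
    have := (hRmp.integrable_comp_emb hRe).2 hFd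
    refine this.congr (Filter.Eventually.of_forall fun x => ?_)
    simp only [Function.comp, hdR]
  have hFRval : ∫ x, F (R x) * d x = ∫ x, F x * d x := by
    rw [← hRmp.integral_comp hRe (fun x => F x * d x)]
    simp only [hdR]
  have hSd : Integrable fun x => S x * d x := by
    have := hFd.add hFRd
    refine this.congr (Filter.Eventually.of_forall fun x => ?_)
    simp only [hS, Pi.add_apply]; ring
  have hSval : ∫ x, S x * d x = 2 * ∫ x, F x * d x := by
    rw [two_mul]
    nth_rewrite 2 [← hFRval]
    rw [← integral_add hFd hFRd]
    congr 1; ext x; simp only [hS]; ring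
  have hSTd : Integrable fun x => S (e - x) * d x := by
    have := (hSd.comp_sub_left e).neg
    refine this.congr (Filter.Eventually.of_forall fun x => ?_)
    simp only [Pi.neg_apply, hdT]; ring
  have hSTval : ∫ x, S (e - x) * d x = - ∫ x, S x * d x := by
    rw [← integral_sub_left_eq_self (fun x => S x * d x) volume e, ← integral_neg]
    congr 1; ext x; rw [hdT]; ring
  have hSform : ∀ x, S x = x i * (sg (x i + (∑ j, x j - x i)) + sg (x i - (∑ j, x j - x i))) := by
    intro x
    simp only [hS, hF, hRi, hRsum]
    rw [show x i + (∑ j, x j - x i) = ∑ j, x j by ring]; ring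
  have hSTform : ∀ x, S (e - x) = (ν - x i) * (sg ((ν - x i) + (∑ j, x j - x i))
      + sg ((ν - x i) - (∑ j, x j - x i))) := by
    intro x
    rw [hSform]
    simp only [Pi.sub_apply, Finset.sum_sub_distrib, hes, hei]
    rw [add_comm (sg _) (sg _)]
    congr 3 <;> ring
  have hprod : ∀ x, wt φ x = φ i (x i) * ∏ j ∈ Finset.univ.erase i, φ j (x j) := fun x =>
    (Finset.mul_prod_erase _ _ (Finset.mem_univ i)).symm
  have hdform : ∀ x, d x = (φ i (x i - ν) - φ i (x i)) *
      ∏ j ∈ Finset.univ.erase i, φ j (x j) := by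
    intro x
    simp only [hd]
    rw [hprod, hprod x, Pi.sub_apply, hei, sub_mul]
    congr 2
    refine Finset.prod_congr rfl fun j hj => ?_
    simp [he, Finset.ne_of_mem_erase hj]
  have hpos : ∀ x, 0 ≤ (S x - S (e - x)) * d x := by
    intro x
    have hp : 0 ≤ ∏ j ∈ Finset.univ.erase i, φ j (x j) :=
      Finset.prod_nonneg fun j _ => (hφ j).1.2.1 _
    rw [hdform, ← mul_assoc]
    refine mul_nonneg ?_ hp
    rw [hSform, hSTform]
    have habs : |x i - ν| = |ν - x i| := abs_sub_comm _ _
    rcases le_total |ν - x i| |x i| with h | h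
    · refine mul_nonneg (sub_nonneg.2 (pair_mono _ h)) (sub_nonneg.2 ((hφ i).2.2 _ _ ?_))
      simpa [habs] using h
    · refine mul_nonneg_of_nonpos_of_nonpos (sub_nonpos.2 (pair_mono _ h))
        (sub_nonpos.2 ((hφ i).2.2 _ _ ?_))
      simpa [habs] using h
  have hfin : 0 ≤ ∫ x, (S x - S (e - x)) * d x := integral_nonneg hpos
  simp_rw [sub_mul] at hfin
  rw [integral_sub hSd hSTd, hSTval, hSval] at hfin
  linarith

end weighted

/-- The all-zero profile (all utilities bidding according to prediction) is the
unique pure strategy Nash equilibrium of the utility bidding game under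
piecewise-linear symmetric pricing. (Theorem 3.) -/
theorem all_zero_unique_nash_equilibrium
    (N : ℕ) (hN : 2 ≤ N)
    (φ : Fin N → ℝ → ℝ) (D : Fin N → ℝ) (σ2 : Fin N → ℝ)
    (hφ : ∀ i, SymmUnimodal (φ i) 0)
    (hD : ∀ i, 0 < D i)
    (hmom : ∀ i, Integrable (fun x => x ^ 2 * φ i x))
    (hσ : ∀ i, ∫ x, x ^ 2 * φ i x = σ2 i)
    (pd a₁ a₂ b₁ b₂ : ℝ)
    (hpd : 0 < pd) (ha : a₁ = a₂) (ha1 : 0 < a₁)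
    (hb : b₁ + b₂ = 2) (hb12 : b₂ < b₁) (hb2 : 0 < b₂) :
    (∀ i : Fin N, ∀ ν : ℝ,
      cost φ D (spotPrice a₁ a₂ b₁ b₂ pd) pd i (fun _ => 0)
        ≤ cost φ D (spotPrice a₁ a₂ b₁ b₂ pd) pd i
            (Function.update (fun _ => (0 : ℝ)) i ν)) ∧
    (∀ μ : Fin N → ℝ,
      (∀ i : Fin N, ∀ ν : ℝ,
        cost φ D (spotPrice a₁ a₂ b₁ b₂ pd) pd i μ
          ≤ cost φ D (spotPrice a₁ a₂ b₁ b₂ pd) pd i (Function.update μ i ν)) →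
      ∀ i, μ i = 0) := by
  subst ha
  have hc : 0 < (b₁ - b₂) / 2 := by linarith
  set c := (b₁ - b₂) / 2 with hcdef
  have hce := fun i μ => cost_eq hφ hmom D pd a₁ b₁ b₂ hb i μ
  rw [← hcdef] at hce
  have hk : ∀ i, 0 < pd / D i := fun i => div_pos hpd (hD i)
  have hsum : ∀ (μ : Fin N → ℝ) i ν, ∑ j, Function.update μ i ν j = ∑ j, μ j - μ i + ν := by
    intro μ i ν
    rw [← Finset.add_sum_erase _ _ (Finset.mem_univ i),
      ← Finset.add_sum_erase _ μ (Finset.mem_univ i), Function.update_self,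
      Finset.sum_congr rfl fun j hj =>
        Function.update_of_ne (Finset.ne_of_mem_erase hj) ν μ]
    ring
  constructor
  · intro i ν
    rw [hce, hce, hsum, Function.update_self]
    simp only [Finset.sum_const_zero, sub_zero, zero_add, mul_zero, zero_mul, add_zero]
    have h := mul_le_mul_of_nonneg_left (exist_ineq hφ hmom i ν) hc.le
    have h2 : 0 ≤ a₁ * (ν * ν) := mul_nonneg ha1.le (mul_self_nonneg ν)
    have := mul_le_mul_of_nonneg_left
      (show a₁ * VV φ i + c * HH φ i 0 ≤ a₁ * (VV φ i + ν * ν) + c * (ν * GG φ ν + HH φ i ν) by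
        linarith) (hk i).le
    linarith
  · intro μ hμ
    have key : ∀ i ν, a₁ * (μ i * ∑ j, μ j) + c * (μ i * GG φ (∑ j, μ j) + HH φ i (∑ j, μ j)) ≤
        a₁ * (ν * (∑ j, μ j - μ i + ν)) + c * (ν * GG φ (∑ j, μ j - μ i + ν)
          + HH φ i (∑ j, μ j - μ i + ν)) := by
      intro i ν
      have h := hμ i ν
      rw [hce, hce, hsum, Function.update_self] at h
      have h2 := le_of_mul_le_mul_left ((add_le_add_iff_left pd).1 h) (hk i)
      linarith
    have hM : ∑ j, μ j = 0 := by
      set M := ∑ j, μ j with hMdef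
      have h1 : ∀ i, a₁ * (μ i * M) + c * (μ i * GG φ M + HH φ i M) ≤ c * HH φ i 0 := by
        intro i
        have := key i (μ i - M)
        rw [show M - μ i + (μ i - M) = 0 by ring, GG_zero hφ] at this
        linarith
      have h2 := Finset.sum_le_sum fun i (_ : i ∈ Finset.univ) => h1 i
      rw [Finset.sum_add_distrib, ← Finset.mul_sum, ← Finset.mul_sum, ← Finset.mul_sum,
        Finset.sum_add_distrib, ← Finset.sum_mul, ← Finset.sum_mul, ← hMdef] at h2
      have h3 := mul_le_mul_of_nonneg_left (A_ge hφ hmom M) hc.le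
      have h4 : a₁ * (M * M) ≤ 0 := by linarith
      have h5 : M * M ≤ 0 := by
        by_contra hcon
        have := mul_pos ha1 (not_le.1 hcon)
        linarith
      exact mul_self_eq_zero.1 (le_antisymm h5 (mul_self_nonneg M))
    rw [hM] at key
    set A := ∑ j, |μ j| with hA
    have hA0 : 0 ≤ A := Finset.sum_nonneg fun j _ => abs_nonneg _
    have hNpos : (0 : ℝ) < N := by exact_mod_cast (by omega : 0 < N)
    set t := A / (2 * N) with ht
    have ht0 : 0 ≤ t := by positivity
    have hNt : N * t = A / 2 := by rw [ht]; field_simp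
    have h1 : ∀ i, c * HH φ i 0 ≤ (t - |μ i|) * (a₁ * t + c * GG φ t) + c * HH φ i t := by
      intro i
      rcases le_total 0 (μ i) with h | h
      · have := key i (μ i - t)
        rw [show 0 - μ i + (μ i - t) = -t by ring, GG_zero hφ, GG_neg hφ, HH_neg hφ] at this
        rw [abs_of_nonneg h]
        linarith
      · have := key i (μ i + t)
        rw [show 0 - μ i + (μ i + t) = t by ring, GG_zero hφ] at this
        rw [abs_of_nonpos h]
        linarith
    have h2 := Finset.sum_le_sum fun i (_ : i ∈ Finset.univ) => h1 i
    rw [Finset.sum_add_distrib, ← Finset.mul_sum, ← Finset.mul_sum, ← Finset.sum_mul,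
      Finset.sum_sub_distrib, Finset.sum_const, Finset.card_univ, Fintype.card_fin, nsmul_eq_mul,
      ← hA, hNt] at h2
    have h3 := mul_le_mul_of_nonneg_left (K_le hφ hmom t) hc.le
    have hAz : A = 0 := by
      by_contra hne
      have hAp : 0 < A := lt_of_le_of_ne hA0 (Ne.symm hne)
      have htp : 0 < t := by positivity
      have hg := mul_nonneg hc.le (GG_nonneg hφ hmom ht0)
      have : 0 < a₁ * t + c * GG φ t := by
        have := mul_pos ha1 htp
        linarith
      have := mul_pos (half_pos hAp) this
      linarith
    intro i
    have := (Finset.sum_eq_zero_iff_of_nonneg fun j _ => abs_nonneg (μ j)).1 hAz i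
      (Finset.mem_univ i)
    exact abs_eq_zero.1 this
end

section
/- Let φ and g be probability densities on ℝ, each symmetric unimodal about 0, with σ² := ∫_ℝ x²φ(x)dx finite. Let D > 0, p_d > 0, a₁ = a₂ > 0, b₁ + b₂ = 2, b₁ > b₂ > 0, and define C(μ) := p_d + (p_d/D)·[ ((a₁+a₂)/2)·(σ² + μ²) + (b₁ − b₂)·∫_ℝ δ·φ(δ − μ)·( ∫_{−δ}^{0} g(s) ds ) dδ ]. Then C is uniquely minimized at μ = 0, and C is strictly increasing with respect to |μ|: whenever |μ₂| < |μ₁|, C(μ₂) < C(μ₁). -/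
open MeasureTheory intervalIntegral

theorem aux_mono_s7 (φ H : ℝ → ℝ) (hs : ∀ x, φ (-x) = φ x)
    (hu : ∀ x y, |y| ≤ |x| → φ x ≤ φ y) (hH : ∀ x y, |x| ≤ |y| → H x ≤ H y)
    (hint : ∀ μ : ℝ, Integrable (fun δ : ℝ => H δ * φ (δ - μ)))
    (m M : ℝ) (hm : 0 ≤ m) (hM : m ≤ M) :
    ∫ δ, H δ * φ (δ - m) ≤ ∫ δ, H δ * φ (δ - M) := by
  have e1 : ∀ μ : ℝ, ∫ δ, H (m + M - δ) * φ ((m + M - δ) - μ) = ∫ δ, H δ * φ (δ - μ) := fun μ =>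
    integral_sub_left_eq_self (fun δ => H δ * φ (δ - μ)) volume (m + M)
  have i1 : ∀ μ : ℝ, Integrable (fun δ => H (m + M - δ) * φ ((m + M - δ) - μ)) := fun μ =>
    (hint μ).comp_sub_left (m + M)
  have h : ∫ δ, (H δ * φ (δ - m) + H (m + M - δ) * φ ((m + M - δ) - m)) ≤
      ∫ δ, (H δ * φ (δ - M) + H (m + M - δ) * φ ((m + M - δ) - M)) := by
    apply integral_mono ((hint m).add (i1 m)) ((hint M).add (i1 M))
    intro δ
    have k1 : φ ((m + M - δ) - m) = φ (δ - M) := by rw [← hs]; congr 1; ring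
    have k2 : φ ((m + M - δ) - M) = φ (δ - m) := by rw [← hs]; congr 1; ring
    simp only [Pi.add_apply, k1, k2]
    rcases le_total (m + M) (2 * δ) with hd | hd
    · have a1 : H (m + M - δ) ≤ H δ := hH _ _ (sq_le_sq.mp (by nlinarith))
      have a2 : φ (δ - m) ≤ φ (δ - M) := hu _ _ (sq_le_sq.mp (by nlinarith))
      nlinarith [mul_nonneg (sub_nonneg.2 a1) (sub_nonneg.2 a2)]
    · have a1 : H δ ≤ H (m + M - δ) := hH _ _ (sq_le_sq.mp (by nlinarith))
      have a2 : φ (δ - M) ≤ φ (δ - m) := hu _ _ (sq_le_sq.mp (by nlinarith))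
      nlinarith [mul_nonneg (sub_nonneg.2 a1) (sub_nonneg.2 a2)]
  rw [integral_add (hint m) (i1 m), integral_add (hint M) (i1 M), e1, e1] at h
  linarith

theorem aux_abs (φ H : ℝ → ℝ) (hs : ∀ x, φ (-x) = φ x) (hH : ∀ x y, |x| ≤ |y| → H x ≤ H y)
    (μ : ℝ) : ∫ δ, H δ * φ (δ - |μ|) = ∫ δ, H δ * φ (δ - μ) := by
  rcases abs_choice μ with h | h
  · rw [h]
  · rw [h, ← integral_neg_eq_self (fun δ => H δ * φ (δ - μ)) volume]
    congr 1
    ext δ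
    have h1 : H (-δ) = H δ := le_antisymm (hH _ _ (by simp)) (hH _ _ (by simp))
    have h2 : φ (-δ - μ) = φ (δ - -μ) := by rw [← hs]; congr 1; ring
    rw [h1, h2]

theorem aux_H (g : ℝ → ℝ) (hg : SymmUnimodal g 0) (x y : ℝ) (hxy : |x| ≤ |y|) :
    x * (∫ s in (-x)..(0 : ℝ), g s) ≤ y * (∫ s in (-y)..(0 : ℝ), g s) := by
  obtain ⟨⟨_, hn, h1⟩, hs, _⟩ := hg
  have hi : Integrable g := by
    by_contra h
    rw [integral_undef h] at h1
    norm_num at h1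
  have hs' : ∀ x, g (-x) = g x := fun x => by simpa using (hs x).symm
  have e : ∀ x : ℝ, ∫ s in (-x)..(0 : ℝ), g s = ∫ s in (0 : ℝ)..x, g s := fun x => by
    have := intervalIntegral.integral_comp_neg (a := 0) (b := x) g
    simp only [hs', neg_zero] at this
    exact this.symm
  have ea : ∀ x : ℝ, x * (∫ s in (-x)..(0 : ℝ), g s) = |x| * ∫ s in (0 : ℝ)..|x|, g s := fun x => by
    rcases abs_choice x with h | h
    · rw [h, e]
    · rw [h, intervalIntegral.integral_symm 0 (-x)]
      ring
  rw [ea, ea]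
  have hm : ∫ s in (0 : ℝ)..|x|, g s ≤ ∫ s in (0 : ℝ)..|y|, g s :=
    intervalIntegral.integral_mono_interval le_rfl (abs_nonneg x) hxy
      (Filter.Eventually.of_forall hn) hi.intervalIntegrable
  exact mul_le_mul hxy hm (intervalIntegral.integral_nonneg (abs_nonneg x) (fun u _ => hn u))
    (abs_nonneg y)

/-- Given that all other utilities bid according to prediction, the expected
average buying cost of utility `i` is uniquely minimized at `μ = 0` and strictly
increasing in `|μ|`. (Corollary 1.) -/
theorem cost_strictly_increasing_in_deviation
    (φ g : ℝ → ℝ) (hφ : SymmUnimodal φ 0) (hg : SymmUnimodal g 0)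
    (σ2 : ℝ) (hmom : Integrable (fun x => x ^ 2 * φ x))
    (hσ : ∫ x, x ^ 2 * φ x = σ2)
    (D pd a₁ a₂ b₁ b₂ : ℝ)
    (hD : 0 < D) (hpd : 0 < pd) (ha : a₁ = a₂) (ha1 : 0 < a₁)
    (hb : b₁ + b₂ = 2) (hb12 : b₂ < b₁) (hb2 : 0 < b₂)
    (hint : ∀ μ : ℝ, Integrable (fun δ : ℝ =>
      δ * φ (δ - μ) * (∫ s in (-δ)..(0 : ℝ), g s)))
    (C : ℝ → ℝ)
    (hC : ∀ μ, C μ = pd + (pd / D) * ((a₁ + a₂) / 2 * (σ2 + μ ^ 2)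
      + (b₁ - b₂) * ∫ δ : ℝ, δ * φ (δ - μ) * (∫ s in (-δ)..(0 : ℝ), g s))) :
    (∀ μ : ℝ, μ ≠ 0 → C 0 < C μ) ∧
    (∀ μ₁ μ₂ : ℝ, |μ₂| < |μ₁| → C μ₂ < C μ₁) := by
  have key : ∀ μ₁ μ₂ : ℝ, |μ₂| < |μ₁| → C μ₂ < C μ₁ := by
    intro μ₁ μ₂ h
    have hs : ∀ x, φ (-x) = φ x := fun x => by simpa using (hφ.2.1 x).symm
    have hu : ∀ x y, |y| ≤ |x| → φ x ≤ φ y := fun x y => by simpa using hφ.2.2 x y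
    have hH := aux_H g hg
    have r : ∀ μ δ : ℝ, δ * φ (δ - μ) * (∫ s in (-δ)..(0 : ℝ), g s) =
        (δ * (∫ s in (-δ)..(0 : ℝ), g s)) * φ (δ - μ) := fun μ δ => by ring
    simp only [r] at hint hC
    have m := aux_mono_s7 φ _ hs hu hH hint |μ₂| |μ₁| (abs_nonneg _) h.le
    rw [aux_abs φ _ hs hH, aux_abs φ _ hs hH] at m
    rw [hC, hC]
    have hsq : μ₂ ^ 2 < μ₁ ^ 2 := sq_lt_sq.mpr h
    have hc : 0 < pd / D := div_pos hpd hD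
    have hA : 0 < (a₁ + a₂) / 2 := by linarith
    have m2 := mul_le_mul_of_nonneg_left m (sub_pos.2 hb12).le
    have m3 := mul_lt_mul_of_pos_left hsq hA
    have := mul_lt_mul_of_pos_left (show (a₁ + a₂) / 2 * (σ2 + μ₂ ^ 2) + _ <
      (a₁ + a₂) / 2 * (σ2 + μ₁ ^ 2) + _ from
        add_lt_add_of_lt_of_le (by rw [mul_add, mul_add]; linarith) m2) hc
    linarith
  exact ⟨fun μ hμ => key μ 0 (by simpa using hμ), key⟩
end

section
/- Let f be a probability density on ℝ symmetric unimodal about 0 with σ² := ∫_ℝ x²f(x)dx finite, let D > 0, and let p_s be the piecewise-linear symmetric spot pricing with day-ahead price p_d > 0, parameters a₁ = a₂ > 0, b₁ + b₂ = 2, b₁ > b₂ > 0. Define the market-level expected average buying cost T(μ) := p_d + (1/D)·( ∫_ℝ p_s(δ)·δ·f(δ − μ) dδ − p_d·μ ). Then T is minimized at μ = 0 and T is strictly increasing with respect to |μ|: whenever |μ₂| < |μ₁|, T(μ₂) < T(μ₁). Consequently the all-zero strategy profile (for which μ = ∑_i μ_i = 0) incurs no loss of efficiency. -/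
open MeasureTheory

lemma spot_mul_eq (a b₁ b₂ pd δ : ℝ) (hb : b₁ + b₂ = 2) :
    spotPrice a a b₁ b₂ pd δ * δ = pd * (a * δ ^ 2 + δ + (b₁ - b₂) / 2 * |δ|) := by
  obtain rfl : b₂ = 2 - b₁ := by linarith
  unfold spotPrice
  split_ifs with h1 h2
  · rw [abs_of_pos h1]; ring
  · rw [abs_of_neg h2]; ring
  · obtain rfl : δ = 0 := by linarith
    simp

lemma abs_sum_le (x μ ν : ℝ) (h : |ν| ≤ |μ|) :
    |x + ν| + |ν - x| ≤ |x + μ| + |μ - x| := by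
  rcases abs_cases ν with ⟨e1, _⟩ | ⟨e1, _⟩ <;> rcases abs_cases μ with ⟨e2, _⟩ | ⟨e2, _⟩ <;>
  rcases abs_cases (x + ν) with ⟨e3, _⟩ | ⟨e3, _⟩ <;>
  rcases abs_cases (ν - x) with ⟨e4, _⟩ | ⟨e4, _⟩ <;>
  rw [e1, e2] at h <;> rw [e3, e4] <;>
  linarith [le_abs_self (x + μ), neg_abs_le (x + μ), le_abs_self (μ - x), neg_abs_le (μ - x)]

/-- The market-level expected average buying cost is minimized at aggregate
strategy `μ = 0` and strictly increasing in `|μ|`; hence the all-zero Nash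
equilibrium incurs no loss of efficiency. (Theorem 4.) -/
theorem market_cost_minimized_at_zero
    (f : ℝ → ℝ) (hf : SymmUnimodal f 0)
    (σ2 : ℝ) (hmom : Integrable (fun x => x ^ 2 * f x))
    (hσ : ∫ x, x ^ 2 * f x = σ2)
    (D pd a₁ a₂ b₁ b₂ : ℝ)
    (hD : 0 < D) (hpd : 0 < pd) (ha : a₁ = a₂) (ha1 : 0 < a₁)
    (hb : b₁ + b₂ = 2) (hb12 : b₂ < b₁) (hb2 : 0 < b₂)
    (hint : ∀ μ : ℝ, Integrable (fun δ : ℝ =>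
      spotPrice a₁ a₂ b₁ b₂ pd δ * δ * f (δ - μ)))
    (T : ℝ → ℝ)
    (hT : ∀ μ, T μ = pd + (1 / D) *
      ((∫ δ : ℝ, spotPrice a₁ a₂ b₁ b₂ pd δ * δ * f (δ - μ)) - pd * μ)) :
    (∀ μ : ℝ, T 0 ≤ T μ) ∧
    (∀ μ₁ μ₂ : ℝ, |μ₂| < |μ₁| → T μ₂ < T μ₁) := by
  subst ha
  obtain ⟨⟨-, hf0, hf1⟩, hsym, -⟩ := hf
  have hfi : Integrable f := by
    by_contra h
    rw [integral_undef h] at hf1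
    exact zero_ne_one hf1
  set h : ℝ → ℝ := fun δ => spotPrice a₁ a₁ b₁ b₂ pd δ * δ with hh
  have i1 : ∀ μ, Integrable (fun x => h (x + μ) * f x) := fun μ => by
    have := (hint μ).comp_add_right μ
    simpa [hh] using this
  have e1 : ∀ μ, ∫ δ, h δ * f (δ - μ) = ∫ x, h (x + μ) * f x := fun μ => by
    have := integral_add_right_eq_self (μ := volume) (fun δ => h δ * f (δ - μ)) μ
    rw [← this]; simp
  have hs : ∀ x, f (-x) = f x := fun x => by simpa using (hsym x).symm
  have i2 : ∀ μ, Integrable (fun x => h (μ - x) * f x) := fun μ => by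
    have := (i1 μ).comp_neg
    simpa [hs, neg_add_eq_sub] using this
  have e2 : ∀ μ, ∫ δ, h δ * f (δ - μ) = ∫ x, h (μ - x) * f x := fun μ => by
    rw [e1, ← integral_neg_eq_self]
    simp [hs, neg_add_eq_sub]
  have key : ∀ μ ν, |ν| ≤ |μ| →
      2 * ((∫ δ, h δ * f (δ - ν)) - pd * ν) + 2 * pd * a₁ * (μ ^ 2 - ν ^ 2) ≤
      2 * ((∫ δ, h δ * f (δ - μ)) - pd * μ) := by
    intro μ ν hle
    have hm : ∫ x, ((h (x + ν) * f x + h (ν - x) * f x) +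
        (2 * pd * (μ - ν) + 2 * pd * a₁ * (μ ^ 2 - ν ^ 2)) * f x) ≤
        ∫ x, (h (x + μ) * f x + h (μ - x) * f x) := by
      refine integral_mono (((i1 ν).add (i2 ν)).add (hfi.const_mul _)) ((i1 μ).add (i2 μ)) ?_
      intro x
      have hp : h (x + ν) + h (ν - x) + (2 * pd * (μ - ν) + 2 * pd * a₁ * (μ ^ 2 - ν ^ 2)) ≤
          h (x + μ) + h (μ - x) := by
        simp only [hh, spot_mul_eq _ _ _ _ _ hb]
        have hc : 0 ≤ pd * ((b₁ - b₂) / 2) := by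
          apply mul_nonneg hpd.le; linarith
        have := mul_le_mul_of_nonneg_left (abs_sum_le x μ ν hle) hc
        linarith
      have := mul_le_mul_of_nonneg_right hp (hf0 x)
      simp only
      linarith
    have i3 : Integrable (fun x => h (x + ν) * f x + h (ν - x) * f x) := (i1 ν).add (i2 ν)
    rw [integral_add i3 (hfi.const_mul _), integral_add (i1 ν) (i2 ν),
      integral_add (i1 μ) (i2 μ), integral_const_mul, hf1, ← e1, ← e2, ← e1, ← e2] at hm
    linarith
  have strict : ∀ μ₁ μ₂ : ℝ, |μ₂| < |μ₁| → T μ₂ < T μ₁ := by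
    intro μ ν hlt
    have k := key μ ν hlt.le
    have hq : 0 < 2 * pd * a₁ * (μ ^ 2 - ν ^ 2) :=
      mul_pos (by positivity) (sub_pos.2 (sq_lt_sq.2 hlt))
    rw [hT, hT]
    have hD' : 0 < 1 / D := by positivity
    gcongr ?_ + _ * ?_
    simp only [hh] at k
    linarith
  refine ⟨fun μ => ?_, strict⟩
  rcases eq_or_ne μ 0 with rfl | hμ
  · exact le_rfl
  · exact (strict μ 0 (by simpa using hμ)).le
end

section
/- Let φ and g be probability densities on ℝ, each symmetric unimodal about 0, with σ² := ∫_ℝ x²φ(x)dx finite, let D > 0, p_d > 0, a₁ = a₂ > 0, b₁ + b₂ = 2, b₁ > b₂ > 0. For m ∈ ℝ define the cost of a rational utility j (who bids according to prediction, μ_j = 0) when the aggregate deviation of the irrational utilities is m: C_j(m) := p_d + (p_d/D)·[ ((a₁+a₂)/2)·σ² + (b₁ − b₂)·V(m) ], where V(m) := ∫_ℝ δ·φ(δ)·( ∫_{−δ−m}^{0} g(s) ds ) dδ (signed integral). Then: (i) V(−m) = V(m); (ii) V(m) ≤ V(0) for all m, so C_j(m) ≤ C_j(0); (iii) C_j is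 nonincreasing with respect to |m|; and (iv) if φ or g is strictly central dominant, then C_j is strictly decreasing with respect to |m|: |m₂| < |m₁| implies C_j(m₁) < C_j(m₂). Hence the all-zero equilibrium is (0, N−1) fault immune: irrational deviations of any group of other utilities can only decrease a rational utility's cost. -/
open MeasureTheory intervalIntegral

/-- `f` is strictly central dominant about `ξ`. -/
def StrictCentralDominant (f : ℝ → ℝ) (ξ : ℝ) : Prop :=
  ∀ x y, |y - ξ| < |x - ξ| → f x < f y


theorem periodic_limit (f : ℝ → ℝ) (p l : ℝ) (hp : 0 < p) (hf : ∀ x, f (x + p) = f x)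
    (hl : Filter.Tendsto f Filter.atTop (nhds l)) (x : ℝ) : f x = l := by
  have h1 : ∀ n : ℕ, f (x + n * p) = f x := by
    intro n
    induction n with
    | zero => simp
    | succ k ih =>
      rw [← ih, ← hf (x + k * p)]
      congr 1
      push_cast
      ring
  have h2 : Filter.Tendsto (fun n : ℕ => x + (n : ℝ) * p) Filter.atTop Filter.atTop :=
    Filter.tendsto_atTop_add_const_left _ _
      (tendsto_natCast_atTop_atTop.atTop_mul_const hp)
  have h3 := hl.comp h2
  have h4 : (f ∘ fun n : ℕ => x + (n : ℝ) * p) = fun _ => f x := by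
    funext n
    exact h1 n
  rw [h4] at h3
  exact tendsto_nhds_unique tendsto_const_nhds h3

theorem density_integrable {f : ℝ → ℝ} (hf : IsDensity f) : Integrable f := by
  by_contra h
  have := hf.2.2
  rw [integral_undef h] at this
  norm_num at this

/-- `D` as an integral. -/
theorem diff_eq (g : ℝ → ℝ) (hg : Integrable g) (δ m₁ m₂ : ℝ) :
    ((∫ s in (0:ℝ)..(δ + m₂), g s) + (∫ s in (0:ℝ)..(δ - m₂), g s))
      - ((∫ s in (0:ℝ)..(δ + m₁), g s) + (∫ s in (0:ℝ)..(δ - m₁), g s))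
    = ∫ t in m₂..m₁, (g (δ - t) - g (δ + t)) := by
  have hi : ∀ a b, IntervalIntegrable g volume a b := fun a b => hg.intervalIntegrable
  rw [intervalIntegral.integral_sub (hg.comp_sub_left δ).intervalIntegrable
    (hg.comp_add_left δ).intervalIntegrable, intervalIntegral.integral_comp_sub_left,
    intervalIntegral.integral_comp_add_left,
    ← intervalIntegral.integral_interval_sub_left (hi 0 (δ - m₂)) (hi 0 (δ - m₁)),
    ← intervalIntegral.integral_interval_sub_left (hi 0 (δ + m₁)) (hi 0 (δ + m₂))]
  ring

theorem key (φ g : ℝ → ℝ) (hφ : SymmUnimodal φ 0) (hg : SymmUnimodal g 0)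
    (V : ℝ → ℝ)
    (hV : ∀ m, V m = ∫ δ : ℝ, δ * φ δ * (∫ s in (-δ - m)..(0 : ℝ), g s))
    (hint : ∀ m, Integrable (fun δ : ℝ =>
      δ * φ δ * (∫ s in (-δ - m)..(0 : ℝ), g s))) :
    (∀ m, V (-m) = V m) ∧
    (∀ m₁ m₂ : ℝ, 0 ≤ m₂ → m₂ ≤ m₁ → V m₁ ≤ V m₂) ∧
    ((StrictCentralDominant φ 0 ∨ StrictCentralDominant g 0) →
      ∀ m₁ m₂ : ℝ, 0 ≤ m₂ → m₂ < m₁ → V m₁ < V m₂) := by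
  obtain ⟨hφd, hφs, hφu⟩ := hφ
  obtain ⟨hgd, hgs, hgu⟩ := hg
  have hφi := density_integrable hφd
  have hgi := density_integrable hgd
  simp only [zero_add, zero_sub, sub_zero] at hφs hgs hφu hgu
  obtain ⟨G, hG⟩ : ∃ G : ℝ → ℝ, ∀ t, G t = ∫ s in (0:ℝ)..t, g s := ⟨_, fun _ => rfl⟩
  have hGodd : ∀ t, G (-t) = - G t := by
    intro t
    rw [hG, hG, ← intervalIntegral.integral_symm]
    have := intervalIntegral.integral_comp_neg (a := t) (b := 0) g
    rw [neg_zero] at this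
    rw [← this]
    exact intervalIntegral.integral_congr (fun s _ => (hgs s).symm)
  have hin : ∀ δ m : ℝ, (∫ s in (-δ - m)..(0 : ℝ), g s) = G (δ + m) := by
    intro δ m
    rw [intervalIntegral.integral_symm, ← hG, ← hGodd]
    congr 1
    ring
  simp only [hin] at hV hint
  have hGc : Continuous G := by
    have : G = fun t => ∫ s in (0:ℝ)..t, g s := funext hG
    rw [this]
    exact intervalIntegral.continuous_primitive (fun a b => hgi.intervalIntegrable) 0
  have hsym : ∀ m, V (-m) = V m := by
    intro m
    rw [hV, hV, ← integral_neg_eq_self]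
    congr 1
    funext δ
    rw [← hφs δ, show -δ + -m = -(δ + m) by ring, hGodd]
    ring
  -- the difference function
  obtain ⟨E, hE⟩ : ∃ E : ℝ → ℝ → ℝ → ℝ, ∀ m₁ m₂ δ, E m₁ m₂ δ =
    (G (δ + m₂) + G (δ - m₂)) - (G (δ + m₁) + G (δ - m₁)) := ⟨_, fun _ _ _ => rfl⟩
  have hEodd : ∀ m₁ m₂ δ, E m₁ m₂ (-δ) = - E m₁ m₂ δ := by
    intro m₁ m₂ δ
    rw [hE, hE, show -δ + m₂ = -(δ - m₂) by ring, show -δ - m₂ = -(δ + m₂) by ring,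
      show -δ + m₁ = -(δ - m₁) by ring, show -δ - m₁ = -(δ + m₁) by ring]
    simp only [hGodd]
    ring
  have hEint : ∀ m₁ m₂ δ, E m₁ m₂ δ = ∫ t in m₂..m₁, (g (δ - t) - g (δ + t)) := by
    intro m₁ m₂ δ
    rw [hE, ← diff_eq g hgi]
    simp only [hG]
  have hfun : ∀ m₁ m₂, (fun δ => φ δ * (δ * E m₁ m₂ δ)) = fun δ =>
      (δ * φ δ * G (δ + m₂) + δ * φ δ * G (δ + -m₂))
      - (δ * φ δ * G (δ + m₁) + δ * φ δ * G (δ + -m₁)) := by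
    intro m₁ m₂
    funext δ
    rw [hE]
    simp only [← sub_eq_add_neg]
    ring
  have hfi : ∀ m₁ m₂, Integrable (fun δ => φ δ * (δ * E m₁ m₂ δ)) := by
    intro m₁ m₂
    rw [hfun]
    exact ((hint _).add (hint _)).sub ((hint _).add (hint _))
  have hI : ∀ m₁ m₂, ∫ δ, φ δ * (δ * E m₁ m₂ δ) = 2 * (V m₂ - V m₁) := by
    intro m₁ m₂
    have hadd : ∀ m, Integrable (fun δ => δ * φ δ * G (δ + m) + δ * φ δ * G (δ + -m)) :=
      fun m => (hint m).add (hint (-m))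
    rw [hfun, integral_sub (hadd m₂) (hadd m₁),
      integral_add (hint _) (hint _), integral_add (hint _) (hint _),
      ← hV, ← hV, ← hV, ← hV, hsym, hsym]
    ring
  have habs : ∀ δ t : ℝ, 0 ≤ δ → 0 ≤ t → |δ - t| ≤ |δ + t| := by
    intro δ t h1 h2
    rw [abs_of_nonneg (add_nonneg h1 h2), abs_le]
    constructor <;> linarith
  have habs' : ∀ δ t : ℝ, 0 < δ → 0 < t → |δ - t| < |δ + t| := by
    intro δ t h1 h2
    rw [abs_of_pos (add_pos h1 h2), abs_lt]
    constructor <;> linarith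
  have hEpos : ∀ m₁ m₂ δ, 0 ≤ m₂ → m₂ ≤ m₁ → 0 ≤ δ → 0 ≤ E m₁ m₂ δ := by
    intro m₁ m₂ δ h0 h1 hδ
    rw [hEint]
    apply intervalIntegral.integral_nonneg h1
    intro t ht
    exact sub_nonneg.2 (hgu _ _ (habs δ t hδ (h0.trans ht.1)))
  have hδE : ∀ m₁ m₂ δ, 0 ≤ m₂ → m₂ ≤ m₁ → 0 ≤ δ * E m₁ m₂ δ := by
    intro m₁ m₂ δ h0 h1
    rcases le_total 0 δ with h | h
    · exact mul_nonneg h (hEpos _ _ _ h0 h1 h)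
    · have h2 := hEpos m₁ m₂ (-δ) h0 h1 (by linarith)
      rw [hEodd] at h2
      nlinarith
  have hnn : ∀ m₁ m₂, 0 ≤ m₂ → m₂ ≤ m₁ → ∀ δ, 0 ≤ φ δ * (δ * E m₁ m₂ δ) :=
    fun m₁ m₂ h0 h1 δ => mul_nonneg (hφd.2.1 δ) (hδE _ _ _ h0 h1)
  have hmono : ∀ m₁ m₂ : ℝ, 0 ≤ m₂ → m₂ ≤ m₁ → V m₁ ≤ V m₂ := by
    intro m₁ m₂ h0 h1
    have h2 : 0 ≤ ∫ δ, φ δ * (δ * E m₁ m₂ δ) :=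
      MeasureTheory.integral_nonneg (fun δ => hnn m₁ m₂ h0 h1 δ)
    rw [hI] at h2
    linarith
  refine ⟨hsym, hmono, ?_⟩
  intro hst m₁ m₂ h0 h1
  refine lt_of_le_of_ne (hmono m₁ m₂ h0 h1.le) ?_
  intro heq
  have hz : ∫ δ, φ δ * (δ * E m₁ m₂ δ) = 0 := by
    rw [hI, heq]
    ring
  rw [integral_eq_zero_iff_of_nonneg (hnn m₁ m₂ h0 h1.le) (hfi m₁ m₂)] at hz
  have hne : ∀ᵐ δ : ℝ, δ ≠ 0 := by
    simp [ae_iff]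
  rcases hst with hst | hst
  · -- φ is strictly dominant, hence positive
    have hφp : ∀ x, 0 < φ x := by
      intro x
      refine lt_of_le_of_lt (hφd.2.1 (|x| + 1)) (hst _ _ ?_)
      rw [sub_zero, sub_zero, abs_of_pos (a := |x| + 1) (by positivity)]
      linarith
    have hE0 : E m₁ m₂ =ᵐ[volume] fun _ => (0:ℝ) := by
      filter_upwards [hz, hne] with δ h2 h3
      have h4 : φ δ * (δ * E m₁ m₂ δ) = 0 := h2
      simpa [(hφp δ).ne', h3] using h4
    have hEc : Continuous (E m₁ m₂) := by
      have : E m₁ m₂ = fun δ => (G (δ + m₂) + G (δ - m₂)) - (G (δ + m₁) + G (δ - m₁)) :=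
        funext (hE m₁ m₂)
      rw [this]
      fun_prop
    have hE1 : E m₁ m₂ = fun _ => (0:ℝ) :=
      (Continuous.ae_eq_iff_eq volume hEc continuous_const).1 hE0
    have hGl : Filter.Tendsto G Filter.atTop (nhds (1/2)) := by
      have h2 := intervalIntegral_tendsto_integral hgi
        Filter.tendsto_neg_atTop_atBot Filter.tendsto_id
      rw [hgd.2.2] at h2
      have h3 : ∀ t : ℝ, (1/2) * (∫ s in (-t)..(id t), g s) = G t := by
        intro t
        have hi : ∀ a b, IntervalIntegrable g volume a b := fun a b => hgi.intervalIntegrable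
        rw [← intervalIntegral.integral_interval_sub_left (hi 0 _) (hi 0 _), ← hG, ← hG, hGodd]
        simp only [id]
        ring
      have h4 := h2.const_mul (1/2)
      rw [mul_one] at h4
      exact h4.congr h3
    have hA : ∀ x, G (x + (m₁ - m₂)) - G x = 0 := by
      apply periodic_limit (fun x => G (x + (m₁ - m₂)) - G x) (m₁ + m₂) 0 (by linarith)
      · intro x
        have h2 := congrFun hE1 (x + m₁)
        rw [hE] at h2
        rw [show x + (m₁ + m₂) + (m₁ - m₂) = x + m₁ + m₁ by ring,
          show x + (m₁ + m₂) = x + m₁ + m₂ by ring, show x + (m₁ - m₂) = x + m₁ - m₂ by ring]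
        rw [show x + m₁ - m₁ = x by ring] at h2
        linarith
      · have h2 := (hGl.comp (Filter.tendsto_atTop_add_const_right _ (m₁ - m₂)
          Filter.tendsto_id)).sub hGl
        rw [sub_self] at h2
        exact h2
    have h5 := periodic_limit G (m₁ - m₂) (1/2) (by linarith)
      (fun x => sub_eq_zero.1 (hA x)) hGl 0
    rw [hG, intervalIntegral.integral_same] at h5
    norm_num at h5
  · have hEp : ∀ δ, 0 < δ → 0 < E m₁ m₂ δ := by
      intro δ hδ
      rw [hEint]
      apply intervalIntegral.intervalIntegral_pos_of_pos_on _ _ h1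
      · exact ((hgi.comp_sub_left δ).sub (hgi.comp_add_left δ)).intervalIntegrable
      · intro t ht
        refine sub_pos.2 (hst _ _ ?_)
        rw [sub_zero, sub_zero]
        exact habs' δ t hδ (lt_of_le_of_lt h0 ht.1)
    have hφ0 : φ =ᵐ[volume] fun _ => (0:ℝ) := by
      filter_upwards [hz, hne] with δ h2 h3
      have h4 : φ δ * (δ * E m₁ m₂ δ) = 0 := h2
      have h5 : E m₁ m₂ δ ≠ 0 := by
        rcases lt_or_gt_of_ne h3 with h | h
        · have h6 := hEp (-δ) (by linarith)
          rw [hEodd] at h6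
          linarith
        · exact (hEp δ h).ne'
      simpa [h5, h3] using h4
    have h6 := hφd.2.2
    rw [integral_congr_ae hφ0] at h6
    simp at h6



/-- Fault immunity of the all-zero equilibrium: a rational utility's expected
cost can only decrease when the aggregate deviation `m` of the irrational
utilities grows in magnitude. (Theorem 5.) -/
theorem fault_immune_equilibrium
    (φ g : ℝ → ℝ) (hφ : SymmUnimodal φ 0) (hg : SymmUnimodal g 0)
    (σ2 : ℝ) (hmom : Integrable (fun x => x ^ 2 * φ x))
    (hσ : ∫ x, x ^ 2 * φ x = σ2)
    (D pd a₁ a₂ b₁ b₂ : ℝ)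
    (hD : 0 < D) (hpd : 0 < pd) (ha : a₁ = a₂) (ha1 : 0 < a₁)
    (hb : b₁ + b₂ = 2) (hb12 : b₂ < b₁) (hb2 : 0 < b₂)
    (V : ℝ → ℝ)
    (hV : ∀ m, V m = ∫ δ : ℝ, δ * φ δ * (∫ s in (-δ - m)..(0 : ℝ), g s))
    (hint : ∀ m, Integrable (fun δ : ℝ =>
      δ * φ δ * (∫ s in (-δ - m)..(0 : ℝ), g s)))
    (C : ℝ → ℝ)
    (hC : ∀ m, C m = pd + (pd / D) * ((a₁ + a₂) / 2 * σ2 + (b₁ - b₂) * V m)) :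
    (∀ m, V (-m) = V m) ∧
    (∀ m, V m ≤ V 0) ∧
    (∀ m₁ m₂ : ℝ, |m₂| ≤ |m₁| → C m₁ ≤ C m₂) ∧
    ((StrictCentralDominant φ 0 ∨ StrictCentralDominant g 0) →
      ∀ m₁ m₂ : ℝ, |m₂| < |m₁| → C m₁ < C m₂) := by
  obtain ⟨hsym, hmono, hstr⟩ := key φ g hφ hg V hV hint
  have habs : ∀ m, V |m| = V m := by
    intro m
    rcases abs_choice m with h | h
    · rw [h]
    · rw [h, hsym]
  have hp : 0 < pd / D := div_pos hpd hD
  have hbb : 0 < b₁ - b₂ := by linarith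
  refine ⟨hsym, ?_, ?_, ?_⟩
  · intro m
    rw [← habs m]
    exact hmono _ _ le_rfl (abs_nonneg m)
  · intro m₁ m₂ h
    have h1 := hmono _ _ (abs_nonneg m₂) h
    rw [habs, habs] at h1
    rw [hC, hC]
    gcongr
  · intro hs m₁ m₂ h
    have h1 := hstr hs _ _ (abs_nonneg m₂) h
    rw [habs, habs] at h1
    rw [hC, hC]
    gcongr
end

section
/- Let p : ℝ → ℝ be odd, nondecreasing, with lim_{Δ→0} p(Δ) = 0, let b₁ + b₂ = 2 with b₁ ≥ b₂ > 0, p_d > 0, and define the spot price p_s(Δ) = p(Δ) + b₁·p_d for Δ > 0, p_s(Δ) = p(Δ) + b₂·p_d for Δ < 0, p_s(0) = p_d. Let f be a probability density symmetric unimodal about 0, D > 0, and define the market-level expected average buying cost T(μ) := p_d + (1/D)·( ∫_ℝ p_s(δ)·δ·f(δ − μ) dδ − p_d·μ ). Then T is minimized at μ = 0 and T is nondecreasing with respect to |μ|; if moreover p is strictly increasing or b₁ > b₂, then T is strictly increasing with respect to |μ|: |μ₂| < |μ₁| implies T(μ₂) < T(μ₁). Consequently the all-zero Nash equilibrium incurs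 no loss of efficiency under the general symmetric pricing model. -/
open MeasureTheory

/-- General symmetric spot pricing with day-ahead price `pd`. -/
noncomputable def genSpot (p : ℝ → ℝ) (b₁ b₂ pd : ℝ) (Δ : ℝ) : ℝ :=
  if 0 < Δ then p Δ + b₁ * pd
  else if Δ < 0 then p Δ + b₂ * pd
  else pd

/-- Evenness of the smoothed cost. -/
lemma G_even (g f : ℝ → ℝ) (geven : ∀ x, g (-x) = g x) (feven : ∀ x, f (-x) = f x) (μ : ℝ) :
    ∫ δ, g δ * f (δ - -μ) = ∫ δ, g δ * f (δ - μ) := by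
  rw [← integral_neg_eq_self]
  congr 1
  funext x
  rw [geven, ← feven]
  congr 2
  ring

lemma G_abs (g f : ℝ → ℝ) (geven : ∀ x, g (-x) = g x) (feven : ∀ x, f (-x) = f x) (μ : ℝ) :
    ∫ δ, g δ * f (δ - |μ|) = ∫ δ, g δ * f (δ - μ) := by
  rcases abs_choice μ with h | h <;> rw [h]
  exact G_even g f geven feven μ

/-- A symmetric unimodal density is not invariant under a nonzero shift. -/
lemma no_period (f : ℝ → ℝ) (hfi : Integrable f) (f0 : ∀ x, 0 ≤ f x)
    (feven : ∀ x, f (-x) = f x)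
    (funi : ∀ x y, |y| ≤ |x| → f x ≤ f y) (h1 : ∫ x, f x = 1) (s : ℝ) (hs : 0 < s)
    (h : ∀ᵐ x, f (x + s) = f x) : False := by
  have e1 : ∫ x in Set.Ioi 0, f (x + s) = ∫ x in Set.Ioi 0, f x :=
    integral_congr_ae (ae_restrict_of_ae h)
  have e2 : ∫ x in Set.Ioi 0, f (x + s) = ∫ x in Set.Ioi s, f x := by
    have := (measurePreserving_add_right (volume : Measure ℝ) s).setIntegral_preimage_emb
      (measurableEmbedding_addRight s) f (Set.Ioi s)
    simpa using this
  have e3 : ∫ x in Set.Ioc 0 s, f x = 0 := by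
    have h3 := setIntegral_union (μ := volume) (f := f) (s := Set.Ioc 0 s) (t := Set.Ioi s)
      (Set.Ioc_disjoint_Ioi le_rfl) measurableSet_Ioi hfi.integrableOn hfi.integrableOn
    rw [Set.Ioc_union_Ioi_eq_Ioi hs.le] at h3
    linarith
  have key : ∀ x, 0 < x → f x = 0 := by
    intro x hx
    by_contra hne
    have hpos : 0 < f x := lt_of_le_of_ne (f0 x) (Ne.symm hne)
    set t := min x s with ht
    have htp : 0 < t := lt_min hx hs
    have h4 : ∫ y in Set.Ioc 0 t, f x ≤ ∫ y in Set.Ioc 0 t, f y := by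
      refine setIntegral_mono_on ?_ hfi.integrableOn measurableSet_Ioc ?_
      · simp
      · intro y hy
        apply funi
        rw [abs_of_pos hy.1, abs_of_pos hx]
        exact hy.2.trans (min_le_left _ _)
    have h5 : ∫ y in Set.Ioc 0 t, f y ≤ ∫ y in Set.Ioc 0 s, f y := by
      refine setIntegral_mono_set hfi.integrableOn (Filter.Eventually.of_forall f0) ?_
      exact (Set.Ioc_subset_Ioc_right (min_le_right _ _)).eventuallyLE
    have h6 : ∫ y in Set.Ioc 0 t, f x = t * f x := by
      rw [setIntegral_const]
      simp [htp.le]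
    have : 0 < t * f x := mul_pos htp hpos
    linarith
  have hz : ∫ x, f x = 0 := by
    apply integral_eq_zero_of_ae
    have : ∀ᵐ x : ℝ, x ≠ 0 := by simp [ae_iff]
    filter_upwards [this] with x hx
    rcases lt_or_gt_of_ne hx with h | h
    · rw [← feven]
      exact key _ (by linarith)
    · exact key _ h
  linarith

lemma G_key (g f : ℝ → ℝ)
    (gmono : ∀ x y, |x| ≤ |y| → g x ≤ g y)
    (hfi : Integrable f) (f0 : ∀ x, 0 ≤ f x) (feven : ∀ x, f (-x) = f x)
    (funi : ∀ x y, |y| ≤ |x| → f x ≤ f y) (h1 : ∫ x, f x = 1)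
    (hint : ∀ μ, Integrable (fun δ => g δ * f (δ - μ)))
    (a b : ℝ) (ha : 0 ≤ a) (hab : a < b) :
    (∫ δ, g δ * f (δ - a) ≤ ∫ δ, g δ * f (δ - b)) ∧
    ((∀ x y, |x| < |y| → g x < g y) → ∫ δ, g δ * f (δ - a) < ∫ δ, g δ * f (δ - b)) := by
  set h : ℝ → ℝ := fun δ => f (δ - b) - f (δ - a) with hh
  have hanti : ∀ δ, h (a + b - δ) = - h δ := by
    intro δ
    have e1 : f (a + b - δ - b) = f (δ - a) := by
      rw [← feven]; congr 1; ring
    have e2 : f (a + b - δ - a) = f (δ - b) := by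
      rw [← feven]; congr 1; ring
    simp only [hh, e1, e2]; ring
  have hgh : Integrable (fun δ => g δ * h δ) := by
    have := (hint b).sub (hint a)
    refine this.congr (Filter.Eventually.of_forall fun x => ?_)
    simp only [hh, Pi.sub_apply]; ring
  have hghi : ∫ δ, g δ * h δ = (∫ δ, g δ * f (δ - b)) - ∫ δ, g δ * f (δ - a) := by
    rw [← integral_sub (hint b) (hint a)]
    congr 1; funext x; simp only [hh]; ring
  have hgh2 : Integrable (fun δ => g (a + b - δ) * h (a + b - δ)) :=
    hgh.comp_sub_left (a + b)
  have hgh2i : ∫ δ, g (a + b - δ) * h (a + b - δ) = ∫ δ, g δ * h δ :=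
    integral_sub_left_eq_self (fun δ => g δ * h δ) volume (a + b)
  set K : ℝ → ℝ := fun δ => (g δ - g (a + b - δ)) * h δ with hK
  have hKe : K = fun δ => g δ * h δ + g (a + b - δ) * h (a + b - δ) := by
    funext δ; simp only [hK, hanti]; ring
  have hKint : Integrable K := by rw [hKe]; exact hgh.add hgh2
  have hKi : ∫ δ, K δ = 2 * ((∫ δ, g δ * f (δ - b)) - ∫ δ, g δ * f (δ - a)) := by
    rw [hKe, integral_add hgh hgh2, hgh2i, hghi]; ring
  have habs1 : ∀ δ, a + b < 2 * δ → |a + b - δ| < |δ| := by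
    intro δ hδ
    rw [← sq_lt_sq]; nlinarith
  have habs2 : ∀ δ, a + b < 2 * δ → |δ - b| < |δ - a| := by
    intro δ hδ
    rw [← sq_lt_sq]; nlinarith
  have habs3 : ∀ δ, 2 * δ < a + b → |δ| < |a + b - δ| := by
    intro δ hδ
    rw [← sq_lt_sq]; nlinarith
  have habs4 : ∀ δ, 2 * δ < a + b → |δ - a| < |δ - b| := by
    intro δ hδ
    rw [← sq_lt_sq]; nlinarith
  have hK0 : ∀ δ, 0 ≤ K δ := by
    intro δ
    rcases lt_trichotomy (2 * δ) (a + b) with h | h | h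
    · apply mul_nonneg_of_nonpos_of_nonpos
      · linarith [gmono _ _ (habs3 δ h).le]
      · simp only [hh]; linarith [funi _ _ (habs4 δ h).le]
    · have : a + b - δ = δ := by linarith
      simp [hK, this]
    · apply mul_nonneg
      · linarith [gmono _ _ (habs1 δ h).le]
      · simp only [hh]; linarith [funi _ _ (habs2 δ h).le]
  have hI0 : 0 ≤ ∫ δ, K δ := integral_nonneg hK0
  refine ⟨by linarith, fun hg => ?_⟩
  by_contra hcon
  have hI : ∫ δ, K δ = 0 := by linarith
  rw [integral_eq_zero_iff_of_nonneg hK0 hKint] at hI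
  have hne : ∀ᵐ x : ℝ, x ≠ (a + b) / 2 := by simp [ae_iff]
  have hh0 : ∀ᵐ x : ℝ, f (x - b) = f (x - a) := by
    filter_upwards [hI, hne] with x hx hx2
    have hgx : g x - g (a + b - x) ≠ 0 := by
      rcases lt_or_gt_of_ne hx2 with h | h
      · exact (sub_neg.2 (hg _ _ (habs3 x (by linarith)))).ne
      · exact (sub_pos.2 (hg _ _ (habs1 x (by linarith)))).ne'
    have : h x = 0 := by
      rcases mul_eq_zero.1 hx with h | h
      · exact absurd h hgx
      · exact h
    simp only [hh] at this
    linarith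
  apply no_period f hfi f0 feven funi h1 (b - a) (by linarith)
  have hq := (measurePreserving_add_right (volume : Measure ℝ) b).quasiMeasurePreserving.ae hh0
  filter_upwards [hq] with x hx
  have e1 : x + b - b = x := by ring
  have e2 : x + b - a = x + (b - a) := by ring
  rw [e1, e2] at hx
  exact hx.symm

/-- Under the general symmetric pricing model, the market-level expected average
buying cost is minimized at `μ = 0`, nondecreasing in `|μ|`, and strictly
increasing in `|μ|` when `p` is strictly increasing or `b₁ > b₂`; hence the
all-zero Nash equilibrium incurs no loss of efficiency. (Theorem 6, part 3.) -/
theorem general_pricing_market_cost_minimized_at_zero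
    (p : ℝ → ℝ) (hodd : ∀ x, p (-x) = -p x) (hmono : Monotone p)
    (hcont : Filter.Tendsto p (nhds 0) (nhds 0))
    (b₁ b₂ pd : ℝ) (hb : b₁ + b₂ = 2) (hb12 : b₂ ≤ b₁) (hb2 : 0 < b₂)
    (hpd : 0 < pd)
    (f : ℝ → ℝ) (hf : SymmUnimodal f 0)
    (D : ℝ) (hD : 0 < D)
    (hint : ∀ μ : ℝ, Integrable (fun δ : ℝ =>
      genSpot p b₁ b₂ pd δ * δ * f (δ - μ)))
    (T : ℝ → ℝ)
    (hT : ∀ μ, T μ = pd + (1 / D) *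
      ((∫ δ : ℝ, genSpot p b₁ b₂ pd δ * δ * f (δ - μ)) - pd * μ)) :
    (∀ μ : ℝ, T 0 ≤ T μ) ∧
    (∀ μ₁ μ₂ : ℝ, |μ₂| ≤ |μ₁| → T μ₂ ≤ T μ₁) ∧
    ((StrictMono p ∨ b₂ < b₁) →
      ∀ μ₁ μ₂ : ℝ, |μ₂| < |μ₁| → T μ₂ < T μ₁) := by
  obtain ⟨⟨fm, f0, h1⟩, hsym, huni⟩ := hf
  have feven : ∀ x, f (-x) = f x := by
    intro x
    have := hsym x
    simp only [zero_add, zero_sub] at this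
    exact this.symm
  have funi : ∀ x y, |y| ≤ |x| → f x ≤ f y := by simpa using huni
  have hfi : Integrable f := by
    by_contra h
    rw [integral_undef h] at h1
    norm_num at h1
  have p0 : p 0 = 0 := by
    have := hodd 0
    rw [neg_zero] at this
    linarith
  have pnn : ∀ x, 0 ≤ x → 0 ≤ p x := fun x hx => p0 ▸ hmono hx
  set c : ℝ := (b₁ - b₂) / 2 with hc
  have hc0 : 0 ≤ c := by rw [hc]; linarith
  have hb1 : b₁ = 1 + c := by rw [hc]; linarith
  have hb2' : b₂ = 1 - c := by rw [hc]; linarith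
  set g : ℝ → ℝ := fun x => p |x| * |x| + c * pd * |x| with hg
  have hspot : ∀ x, genSpot p b₁ b₂ pd x * x = g x + pd * x := by
    intro x
    simp only [genSpot, hg]
    rcases lt_trichotomy x 0 with h | h | h
    · rw [if_neg (by linarith), if_pos h, abs_of_neg h, hodd, hb2']; ring
    · subst h; simp
    · rw [if_pos h, abs_of_pos h, hb1]; ring
  have geven : ∀ x, g (-x) = g x := by intro x; simp [hg]
  have gmono : ∀ x y, |x| ≤ |y| → g x ≤ g y := by
    intro x y hxy
    simp only [hg]
    have h2 : p |x| * |x| ≤ p |y| * |y| :=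
      mul_le_mul (hmono hxy) hxy (abs_nonneg _) (pnn _ (abs_nonneg _))
    have h3 : c * pd * |x| ≤ c * pd * |y| :=
      mul_le_mul_of_nonneg_left hxy (mul_nonneg hc0 hpd.le)
    linarith
  have gstrict : (StrictMono p ∨ b₂ < b₁) → ∀ x y, |x| < |y| → g x < g y := by
    intro hor x y hxy
    simp only [hg]
    have hy : 0 < |y| := (abs_nonneg x).trans_lt hxy
    rcases hor with hs | hlt
    · have hpy : 0 < p |y| := p0 ▸ hs hy
      have h2 : p |x| * |x| ≤ p |y| * |x| :=
        mul_le_mul_of_nonneg_right (hmono hxy.le) (abs_nonneg _)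
      have h2' : p |y| * |x| < p |y| * |y| := mul_lt_mul_of_pos_left hxy hpy
      have h3 : c * pd * |x| ≤ c * pd * |y| :=
        mul_le_mul_of_nonneg_left hxy.le (mul_nonneg hc0 hpd.le)
      linarith
    · have hcp : 0 < c := by rw [hc]; linarith
      have h2 : p |x| * |x| ≤ p |y| * |y| :=
        mul_le_mul (hmono hxy.le) hxy.le (abs_nonneg _) (pnn _ (abs_nonneg _))
      have h3 : c * pd * |x| < c * pd * |y| :=
        mul_lt_mul_of_pos_left hxy (mul_pos hcp hpd)
      linarith
  -- the first moment exists
  have hm0 : Integrable (fun x : ℝ => x * f x) := by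
    have hA : Integrable (fun x : ℝ => (g x + pd * x) * f x) := by
      have := hint 0
      simpa only [hspot, sub_zero] using this
    have hB : Integrable (fun x : ℝ => (g x - pd * x) * f x) := by
      have := hA.comp_neg
      refine this.congr (Filter.Eventually.of_forall fun x => ?_)
      simp only [geven, feven]; ring
    have := (hA.sub hB).const_mul (1 / (2 * pd))
    refine this.congr (Filter.Eventually.of_forall fun x => ?_)
    simp only [Pi.sub_apply]
    field_simp
    ring
  have hm0i : ∫ x : ℝ, x * f x = 0 := by
    have h2 := integral_neg_eq_self (fun x : ℝ => x * f x) volume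
    simp only [feven, neg_mul, integral_neg] at h2
    linarith
  have hsum : ∀ μ : ℝ, Integrable (fun x : ℝ => x * f x + μ * f x) :=
    fun μ => hm0.add (hfi.const_mul μ)
  have hm : ∀ μ : ℝ, Integrable (fun x : ℝ => x * f (x - μ)) := by
    intro μ
    have := (hsum μ).comp_sub_right μ
    refine this.congr (Filter.Eventually.of_forall fun x => ?_)
    simp only; ring
  have hmi : ∀ μ : ℝ, ∫ x : ℝ, x * f (x - μ) = μ := by
    intro μ
    have h2 := integral_sub_right_eq_self (μ := volume) (fun x : ℝ => x * f x + μ * f x) μ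
    have h3 : ∫ x, (x * f x + μ * f x) = μ := by
      rw [integral_add hm0 (hfi.const_mul μ), integral_const_mul, hm0i, h1]; ring
    rw [h3] at h2
    refine Eq.trans ?_ h2
    congr 1; funext x; ring
  have hgi : ∀ μ, Integrable (fun x => g x * f (x - μ)) := by
    intro μ
    have := (hint μ).sub ((hm μ).const_mul pd)
    refine this.congr (Filter.Eventually.of_forall fun x => ?_)
    simp only [Pi.sub_apply, hspot]; ring
  have hTG : ∀ μ, T μ = pd + (1 / D) * ∫ x, g x * f (x - μ) := by
    intro μ
    rw [hT]
    have : ∫ δ : ℝ, genSpot p b₁ b₂ pd δ * δ * f (δ - μ)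
        = (∫ x, g x * f (x - μ)) + pd * μ := by
      have h4 : ∫ x : ℝ, pd * (x * f (x - μ)) = pd * μ := by
        rw [integral_const_mul, hmi]
      rw [← h4, ← integral_add (hgi μ) ((hm μ).const_mul pd)]
      congr 1; funext x; rw [hspot]; ring
    rw [this]; ring
  have hTabs : ∀ μ, T |μ| = T μ := by
    intro μ
    rw [hTG, hTG, G_abs g f geven feven]
  have hD' : 0 < 1 / D := by positivity
  have hle : ∀ μ₁ μ₂ : ℝ, |μ₂| ≤ |μ₁| → T μ₂ ≤ T μ₁ := by
    intro μ₁ μ₂ h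
    rw [← hTabs μ₁, ← hTabs μ₂]
    rcases h.eq_or_lt with h | h
    · rw [h]
    · rw [hTG, hTG]
      have := (G_key g f gmono hfi f0 feven funi h1 hgi _ _ (abs_nonneg μ₂) h).1
      have := mul_le_mul_of_nonneg_left this hD'.le
      linarith
  refine ⟨fun μ => hle μ 0 (by simp), hle, ?_⟩
  intro hor μ₁ μ₂ h
  rw [← hTabs μ₁, ← hTabs μ₂, hTG, hTG]
  have := (G_key g f gmono hfi f0 feven funi h1 hgi _ _ (abs_nonneg μ₂) h).2 (gstrict hor)
  have := mul_lt_mul_of_pos_left this hD'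
  linarith
end

section
/- Let p : ℝ → ℝ be odd, nondecreasing, differentiable, with lim_{Δ→0} p(Δ) = 0, let b₁ + b₂ = 2 with b₁ ≥ b₂ > 0, p_d > 0, and define the spot price p_s(Δ) = p(Δ) + b₁·p_d for Δ > 0, p_s(Δ) = p(Δ) + b₂·p_d for Δ < 0, p_s(0) = p_d. Let φ and g be probability densities on ℝ, each symmetric unimodal about 0, let D > 0, and for m ∈ ℝ define the cost of a rational utility j (with μ_j = 0) against aggregate irrational deviation m: C_j(m) := ∬_{ℝ×ℝ} [ p_d + δ·(p_s(δ + s) − p_d)/D ] · φ(δ) · g(s − m) ds dδ. Assume either (A) b₁ > b₂ and p′(x₂) ≥ p′(x₁) ≥ 0 for all x₁ > x₂ ≥ 0 and for all x₁ < x₂ ≤ 0, or (B) p′(x₂) > p′(x₁) ≥ 0 for all x₁ > x₂ ≥ 0 and for all x₁ < x₂ ≤ 0. Then C_j(−m) = C_j(m), C_j(m) ≤ C_j(0) for all m, and C_j is nonincreasing with respect to |m|; i.e., the all-zero equilibrium is (0, N−1) fault immune under the general symmetric pricing model. -/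
open MeasureTheory

/-- Increments of a function with antitone derivative are antitone. -/
lemma incr_p (p : ℝ → ℝ) (hdiff : Differentiable ℝ p)
    (h : ∀ x₁ x₂ : ℝ, 0 ≤ x₂ → x₂ < x₁ → deriv p x₁ ≤ deriv p x₂)
    (x y d : ℝ) (hx : 0 ≤ x) (hxy : x ≤ y) (hd : 0 ≤ d) :
    p (y + d) - p y ≤ p (x + d) - p x := by
  have hD : Differentiable ℝ (fun t => p (t + d) - p t) := by fun_prop
  have key : AntitoneOn (fun t => p (t + d) - p t) (Set.Ici 0) := by
    apply antitoneOn_of_deriv_nonpos (convex_Ici 0) hD.continuous.continuousOn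
      hD.differentiableOn
    intro t ht
    rw [interior_Ici] at ht
    have e : deriv (fun t => p (t + d) - p t) t = deriv p (t + d) - deriv p t := by
      have h1 : HasDerivAt (fun t => p (t + d)) (deriv p (t + d)) t :=
        HasDerivAt.comp_add_const t d (hdiff (t + d)).hasDerivAt
      exact (h1.sub (hdiff t).hasDerivAt).deriv
    rw [e]
    rcases hd.eq_or_lt with h0 | h0
    · subst h0; simp
    · have := h (t + d) t (le_of_lt ht) (by linarith)
      linarith
  exact key hx (hx.trans hxy) hxy

/-- Abstract version: the symmetrised kernel is antitone in `|s|`, nonnegative arguments. -/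
lemma ker_anti_pos (q : ℝ → ℝ) (hodd : ∀ x, q (-x) = -q x)
    (hq : ∀ x y d : ℝ, 0 ≤ x → x ≤ y → 0 ≤ d → q (y + d) - q y ≤ q (x + d) - q x)
    (δ s t : ℝ) (hδ : 0 ≤ δ) (hs : 0 ≤ s) (hst : s ≤ t) :
    q (t + δ) - q (t - δ) ≤ q (s + δ) - q (s - δ) := by
  have q0 : q 0 = 0 := by have := hodd 0; simp at this; linarith
  have sub : ∀ x d, 0 ≤ x → 0 ≤ d → q (x + d) ≤ q x + q d := by
    intro x d hx hd
    have := hq 0 x d le_rfl hx hd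
    simp [q0] at this; linarith
  rcases le_total δ s with h | h
  · have := hq (s - δ) (t - δ) (2 * δ) (by linarith) (by linarith) (by linarith)
    rw [show t - δ + 2 * δ = t + δ by ring, show s - δ + 2 * δ = s + δ by ring] at this
    exact this
  have e : q (s - δ) = - q (δ - s) := by rw [← hodd]; congr 1; ring
  rcases le_total t δ with h' | h'
  · have e' : q (t - δ) = - q (δ - t) := by rw [← hodd]; congr 1; ring
    have := hq (δ - t) (δ + s) (t - s) (by linarith) (by linarith) (by linarith)
    rw [show δ + s + (t - s) = t + δ by ring, show δ - t + (t - s) = δ - s by ring,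
      show δ + s = s + δ by ring] at this
    linarith
  · have h1 := sub (t - δ) (s + δ + (δ - s)) (by linarith) (by linarith)
    have h2 := sub (s + δ) (δ - s) (by linarith) (by linarith)
    rw [show t - δ + (s + δ + (δ - s)) = t + δ by ring] at h1
    linarith

lemma ker_anti (q : ℝ → ℝ) (hodd : ∀ x, q (-x) = -q x)
    (hq : ∀ x y d : ℝ, 0 ≤ x → x ≤ y → 0 ≤ d → q (y + d) - q y ≤ q (x + d) - q x)
    (δ s t : ℝ) (hst : |s| ≤ |t|) :
    δ * (q (t + δ) - q (t - δ)) ≤ δ * (q (s + δ) - q (s - δ)) := by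
  have ev : ∀ d x, q (|x| + d) - q (|x| - d) = q (x + d) - q (x - d) := by
    intro d x
    rcases abs_choice x with h | h
    · rw [h]
    · rw [h, show -x + d = -(x - d) by ring, show -x - d = -(x + d) by ring, hodd, hodd]; ring
  rw [← ev δ t, ← ev δ s]
  rcases le_total 0 δ with h | h
  · exact mul_le_mul_of_nonneg_left
      (ker_anti_pos q hodd hq δ |s| |t| h (abs_nonneg _) hst) h
  · have := ker_anti_pos q hodd hq (-δ) |s| |t| (by linarith) (abs_nonneg _) hst
    simp only [sub_neg_eq_add, ← sub_eq_add_neg] at this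
    nlinarith

/-- `(x, y) ↦ (-x, y)` preserves Lebesgue measure on the plane. -/
lemma mp_neg_fst : MeasurePreserving (fun x : ℝ × ℝ => (-x.1, x.2)) volume volume :=
  (Measure.measurePreserving_neg (volume : Measure ℝ)).prod (MeasurePreserving.id volume)

lemma mp_refl_snd (a : ℝ) :
    MeasurePreserving (fun x : ℝ × ℝ => (x.1, a - x.2)) volume volume :=
  (MeasurePreserving.id volume).prod (Measure.measurePreserving_sub_left (volume : Measure ℝ) a)

lemma me_neg_fst : MeasurableEmbedding (fun x : ℝ × ℝ => (-x.1, x.2)) :=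
  ((MeasurableEquiv.neg ℝ).prodCongr (MeasurableEquiv.refl ℝ)).measurableEmbedding

lemma me_refl_snd (a : ℝ) : MeasurableEmbedding (fun x : ℝ × ℝ => (x.1, a - x.2)) :=
  ((MeasurableEquiv.refl ℝ).prodCongr (MeasurableEquiv.subLeft a)).measurableEmbedding

lemma cost_anti (q φ g : ℝ → ℝ) (pd D : ℝ) (hD : 0 < D) (hodd : ∀ x, q (-x) = -q x)
    (hq : ∀ x y d : ℝ, 0 ≤ x → x ≤ y → 0 ≤ d → q (y + d) - q y ≤ q (x + d) - q x)
    (hφ0 : ∀ x, 0 ≤ φ x) (hφe : ∀ x, φ (-x) = φ x)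
    (hge : ∀ x, g (-x) = g x) (hgm : ∀ x y, |y| ≤ |x| → g x ≤ g y)
    (hint : ∀ m, Integrable (fun x : ℝ × ℝ =>
      (pd + x.1 * q (x.1 + x.2) / D) * (φ x.1 * g (x.2 - m))))
    (m n : ℝ) (hn : 0 ≤ n) (hnm : n ≤ m) :
    ∫ x : ℝ × ℝ, (pd + x.1 * q (x.1 + x.2) / D) * (φ x.1 * g (x.2 - m)) ≤
    ∫ x : ℝ × ℝ, (pd + x.1 * q (x.1 + x.2) / D) * (φ x.1 * g (x.2 - n)) := by
  rw [← sub_nonpos, ← integral_sub (hint m) (hint n)]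
  have hW := (hint m).sub (hint n)
  set W : ℝ × ℝ → ℝ := fun x =>
    (pd + x.1 * q (x.1 + x.2) / D) * (φ x.1 * g (x.2 - m)) -
    (pd + x.1 * q (x.1 + x.2) / D) * (φ x.1 * g (x.2 - n)) with hWdef
  replace hW : Integrable W := hW
  change ∫ x, W x ≤ 0
  have hV : Integrable (fun x : ℝ × ℝ => W x + W (-x.1, x.2)) :=
    hW.add (mp_neg_fst.integrable_comp_of_integrable hW)
  have hVi : ∫ x : ℝ × ℝ, (W x + W (-x.1, x.2)) = 2 * ∫ x, W x := by
    have hW2 : Integrable (fun x : ℝ × ℝ => W (-x.1, x.2)) :=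
      mp_neg_fst.integrable_comp_of_integrable hW
    rw [integral_add hW hW2,
      mp_neg_fst.integral_comp me_neg_fst W]; ring
  set V : ℝ × ℝ → ℝ := fun x => W x + W (-x.1, x.2) with hVdef
  have hU : Integrable (fun x : ℝ × ℝ => V (x.1, m + n - x.2)) :=
    (mp_refl_snd (m + n)).integrable_comp_of_integrable hV
  have hUi : ∫ x : ℝ × ℝ, (V x + V (x.1, m + n - x.2)) = 2 * ∫ x, V x := by
    rw [integral_add hV hU, (mp_refl_snd (m + n)).integral_comp (me_refl_snd _) V]; ring
  have hle : ∫ x : ℝ × ℝ, (V x + V (x.1, m + n - x.2)) ≤ 0 := by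
    apply integral_nonpos
    rintro ⟨δ, s⟩
    have e1 : g (m + n - s - m) = g (s - n) := by rw [← hge]; congr 1; ring
    have e2 : g (m + n - s - n) = g (s - m) := by rw [← hge]; congr 1; ring
    have o1 : q (-δ + s) = q (s - δ) := by congr 1; ring
    have o2 : q (-δ + (m + n - s)) = q (m + n - s - δ) := by congr 1; ring
    have o3 : q (δ + s) = q (s + δ) := by congr 1; ring
    have o4 : q (δ + (m + n - s)) = q (m + n - s + δ) := by congr 1; ring
    have main : (g (s - m) - g (s - n)) *
        (δ * (q (s + δ) - q (s - δ)) -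
          δ * (q (m + n - s + δ) - q (m + n - s - δ))) ≤ 0 := by
      rcases le_total (m + n) (2 * s) with h | h
      · apply mul_nonpos_of_nonneg_of_nonpos
        · have := hgm (s - n) (s - m) (by apply sq_le_sq.mp; nlinarith)
          linarith
        · have := ker_anti q hodd hq δ (m + n - s) s (by apply sq_le_sq.mp; nlinarith)
          linarith
      · apply mul_nonpos_of_nonpos_of_nonneg
        · have := hgm (s - m) (s - n) (by apply sq_le_sq.mp; nlinarith)
          linarith
        · have := ker_anti q hodd hq δ s (m + n - s) (by apply sq_le_sq.mp; nlinarith)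
          linarith
    have : V (δ, s) + V (δ, m + n - s) = φ δ / D * ((g (s - m) - g (s - n)) *
        (δ * (q (s + δ) - q (s - δ)) -
          δ * (q (m + n - s + δ) - q (m + n - s - δ)))) := by
      simp only [hVdef, hWdef, e1, e2, o1, o2, o3, o4, hφe]
      ring
    change V (δ, s) + V (δ, m + n - s) ≤ 0
    rw [this]
    exact mul_nonpos_of_nonneg_of_nonpos (div_nonneg (hφ0 _) hD.le) main
  linarith

lemma cost_even (q φ g : ℝ → ℝ) (pd D : ℝ) (hodd : ∀ x, q (-x) = -q x)
    (hφe : ∀ x, φ (-x) = φ x) (hge : ∀ x, g (-x) = g x) (m : ℝ) :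
    ∫ x : ℝ × ℝ, (pd + x.1 * q (x.1 + x.2) / D) * (φ x.1 * g (x.2 - -m)) =
    ∫ x : ℝ × ℝ, (pd + x.1 * q (x.1 + x.2) / D) * (φ x.1 * g (x.2 - m)) := by
  rw [← mp_neg_fst.integral_comp me_neg_fst, ← (mp_refl_snd 0).integral_comp (me_refl_snd 0)]
  congr 1
  ext ⟨δ, s⟩
  have e1 : g (0 - s - -m) = g (s - m) := by rw [← hge]; congr 1; ring
  have o1 : q (-δ + (0 - s)) = - q (δ + s) := by rw [← hodd]; congr 1; ring
  simp only [e1, o1, hφe]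
  ring

/-- Fault immunity of the all-zero equilibrium under the general symmetric
pricing model with concave-for-positive / convex-for-negative increments.
(Theorem 6, part 4.) -/
theorem general_pricing_fault_immune
    (p : ℝ → ℝ) (hodd : ∀ x, p (-x) = -p x) (hmono : Monotone p)
    (hdiff : Differentiable ℝ p)
    (hcont : Filter.Tendsto p (nhds 0) (nhds 0))
    (b₁ b₂ pd : ℝ) (hb : b₁ + b₂ = 2) (hb12 : b₂ ≤ b₁) (hb2 : 0 < b₂)
    (hpd : 0 < pd)
    (φ g : ℝ → ℝ) (hφ : SymmUnimodal φ 0) (hg : SymmUnimodal g 0)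
    (D : ℝ) (hD : 0 < D)
    (C : ℝ → ℝ)
    (hC : ∀ m, C m = ∫ x : ℝ × ℝ,
      (pd + x.1 * (genSpot p b₁ b₂ pd (x.1 + x.2) - pd) / D)
        * (φ x.1 * g (x.2 - m)))
    (hint : ∀ m, Integrable (fun x : ℝ × ℝ =>
      (pd + x.1 * (genSpot p b₁ b₂ pd (x.1 + x.2) - pd) / D)
        * (φ x.1 * g (x.2 - m))))
    (hAB :
      (b₂ < b₁ ∧
        (∀ x₁ x₂ : ℝ, 0 ≤ x₂ → x₂ < x₁ →
          0 ≤ deriv p x₁ ∧ deriv p x₁ ≤ deriv p x₂) ∧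
        (∀ x₁ x₂ : ℝ, x₂ ≤ 0 → x₁ < x₂ →
          0 ≤ deriv p x₁ ∧ deriv p x₁ ≤ deriv p x₂)) ∨
      ((∀ x₁ x₂ : ℝ, 0 ≤ x₂ → x₂ < x₁ →
          0 ≤ deriv p x₁ ∧ deriv p x₁ < deriv p x₂) ∧
        (∀ x₁ x₂ : ℝ, x₂ ≤ 0 → x₁ < x₂ →
          0 ≤ deriv p x₁ ∧ deriv p x₁ < deriv p x₂))) :
    (∀ m, C (-m) = C m) ∧
    (∀ m, C m ≤ C 0) ∧
    (∀ m₁ m₂ : ℝ, |m₂| ≤ |m₁| → C m₁ ≤ C m₂) := by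
  have hp : ∀ x₁ x₂ : ℝ, 0 ≤ x₂ → x₂ < x₁ → deriv p x₁ ≤ deriv p x₂ := by
    intro x₁ x₂ h1 h2
    rcases hAB with ⟨_, h, _⟩ | ⟨h, _⟩
    · exact (h x₁ x₂ h1 h2).2
    · exact (h x₁ x₂ h1 h2).2.le
  have p0 : p 0 = 0 := by have := hodd 0; simp at this; linarith
  have he : 0 ≤ (b₁ - 1) * pd := mul_nonneg (by linarith) hpd.le
  obtain rfl : b₂ = 2 - b₁ := by linarith
  set q : ℝ → ℝ := fun Δ => genSpot p b₁ (2 - b₁) pd Δ - pd with hqdef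
  have qpos : ∀ x, 0 < x → q x = p x + (b₁ - 1) * pd := by
    intro x hx; simp only [hqdef, genSpot, if_pos hx]; ring
  have qneg : ∀ x, x < 0 → q x = p x - (b₁ - 1) * pd := by
    intro x hx; simp only [hqdef, genSpot, if_pos hx, if_neg (not_lt.mpr hx.le)]; ring
  have q0 : q 0 = 0 := by simp [hqdef, genSpot]
  have qodd : ∀ x, q (-x) = -q x := by
    intro x
    rcases lt_trichotomy x 0 with h | h | h
    · rw [qneg x h, qpos (-x) (by linarith), hodd]; ring
    · subst h; simp [q0]
    · rw [qpos x h, qneg (-x) (by linarith), hodd]; ring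
  have qinc : ∀ x y d : ℝ, 0 ≤ x → x ≤ y → 0 ≤ d → q (y + d) - q y ≤ q (x + d) - q x := by
    intro x y d hx hxy hd
    have hi := incr_p p hdiff hp x y d hx hxy hd
    rcases hd.eq_or_lt with h0 | h0
    · subst h0; simp
    rw [qpos (y + d) (by linarith), qpos (x + d) (by linarith)]
    rcases hx.eq_or_lt with h1 | h1
    · subst h1
      rw [q0]
      rcases hxy.eq_or_lt with h2 | h2
      · subst h2; rw [q0]
      · rw [qpos y h2]; rw [p0] at hi; linarith
    · rw [qpos x h1, qpos y (by linarith)]; linarith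
  have hφe : ∀ x, φ (-x) = φ x := fun x => by simpa using (hφ.2.1 x).symm
  have hge : ∀ x, g (-x) = g x := fun x => by simpa using (hg.2.1 x).symm
  have hgm : ∀ x y, |y| ≤ |x| → g x ≤ g y := fun x y h => hg.2.2 x y (by simpa using h)
  have hev : ∀ m, C (-m) = C m := by
    intro m
    rw [hC, hC]
    exact cost_even q φ g pd D qodd hφe hge m
  have habs : ∀ m, C |m| = C m := by
    intro m
    rcases abs_choice m with h | h
    · rw [h]
    · rw [h, hev]
  have hanti : ∀ m₁ m₂ : ℝ, |m₂| ≤ |m₁| → C m₁ ≤ C m₂ := by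
    intro m₁ m₂ h
    rw [← habs m₁, ← habs m₂, hC, hC]
    exact cost_anti q φ g pd D hD qodd qinc hφ.1.2.1 hφe hge hgm hint _ _ (abs_nonneg _) h
  exact ⟨hev, fun m => hanti m 0 (by simp), hanti⟩
end

section
/- Let (Δ_i, Δ_{−i}) be bivariate normal on ℝ² with means μ_i, μ_{−i}, variances σ_i² > 0, σ_{−i}² > 0, and correlation ρ_i ∈ (−1, 1), and let p_s be the piecewise-linear symmetric spot pricing with day-ahead price p_d > 0, parameters a₁ = a₂ > 0, b₁ + b₂ = 2, b₁ > b₂ > 0. Then for D_i > 0, E[ p_d + Δ_i·(p_s(Δ_i + Δ_{−i}) − p_d)/D_i ] = p_d + (p_d/D_i)·[ ((a₁+a₂)/2)·( σ_i² + μ_i² + μ_i·μ_{−i} + ρ_i·σ_i·σ_{−i} ) + ((b₁−b₂)/2)·E[ Δ_i · erf( ( (Δ_i + μ_{−i})/σ_{−i} + ρ_i·(Δ_i − μ_i)/σ_i ) / √(2(1−ρ_i²)) ) ] ], where erf(z) = (2/√π)·∫₀ᶻ e^{−t²} dt and the last expectation is over Δ_i ∼ N(μ_i, σ_i²). -/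
open MeasureTheory intervalIntegral Real

/-- The Gauss error function `erf z = (2/√π) ∫₀ᶻ e^{-t²} dt`. -/
noncomputable def erf (z : ℝ) : ℝ :=
  (2 / Real.sqrt Real.pi) * ∫ t in (0 : ℝ)..z, Real.exp (-t ^ 2)

/-- Gaussian density with mean `μ` and standard deviation `σ`. -/
noncomputable def gaussDensity (μ σ x : ℝ) : ℝ :=
  (Real.sqrt (2 * Real.pi) * σ)⁻¹ * Real.exp (-(x - μ) ^ 2 / (2 * σ ^ 2))

/-- Bivariate normal density with means `μi, μmi`, standard deviations
`σi, σmi`, and correlation `ρ`. -/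
noncomputable def biGaussDensity (μi μmi σi σmi ρ : ℝ) (x : ℝ × ℝ) : ℝ :=
  (2 * Real.pi * σi * σmi * Real.sqrt (1 - ρ ^ 2))⁻¹ *
    Real.exp (-((x.1 - μi) ^ 2 / σi ^ 2 + (x.2 - μmi) ^ 2 / σmi ^ 2
      - 2 * ρ * (x.1 - μi) * (x.2 - μmi) / (σi * σmi)) / (2 * (1 - ρ ^ 2)))

open ProbabilityTheory in
lemma gaussDensity_eq (μ σ : ℝ) (hσ : 0 < σ) (x : ℝ) :
    gaussDensity μ σ x = gaussianPDFReal μ (Real.toNNReal (σ ^ 2)) x := by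
  unfold gaussDensity gaussianPDFReal
  rw [Real.coe_toNNReal _ (sq_nonneg σ), Real.sqrt_mul (by positivity) (σ ^ 2),
    Real.sqrt_sq hσ.le]

open ProbabilityTheory in
lemma gd_integrable (μ σ : ℝ) (hσ : 0 < σ) (k : ℕ) :
    Integrable (fun x => x ^ k * gaussDensity μ σ x) := by
  have hv : Real.toNNReal (σ ^ 2) ≠ 0 := by
    simp [hσ.ne']
  have h := (memLp_id_gaussianReal (μ := μ) (v := Real.toNNReal (σ ^ 2)) (k : NNReal)).integrable_norm_pow'
  have h2 : Integrable (fun x : ℝ => x ^ k) (gaussianReal μ (Real.toNNReal (σ ^ 2))) := by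
    refine h.mono' (by fun_prop) (Filter.Eventually.of_forall fun x => ?_)
    simp
  rw [gaussianReal_of_var_ne_zero _ hv, integrable_withDensity_iff_integrable_smul'
    (measurable_gaussianPDF _ _) (Filter.Eventually.of_forall fun x => gaussianPDF_lt_top)] at h2
  refine h2.congr (Filter.Eventually.of_forall fun x => ?_)
  simp only [toReal_gaussianPDF, smul_eq_mul, gaussDensity_eq μ σ hσ]
  ring

lemma gd_int0 (μ σ : ℝ) (hσ : 0 < σ) : ∫ x, gaussDensity μ σ x = 1 := by
  simp_rw [gaussDensity_eq μ σ hσ]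
  exact ProbabilityTheory.integral_gaussianPDFReal_eq_one _ (by simp [hσ.ne'])

open ProbabilityTheory in
lemma gd_int1 (μ σ : ℝ) (hσ : 0 < σ) : ∫ x, x * gaussDensity μ σ x = μ := by
  have h := integral_id_gaussianReal (μ := μ) (v := Real.toNNReal (σ ^ 2))
  rw [integral_gaussianReal_eq_integral_smul (by simp [hσ.ne'])] at h
  refine Eq.trans ?_ h
  simp_rw [gaussDensity_eq μ σ hσ, smul_eq_mul, mul_comm]

open ProbabilityTheory in
lemma gd_int2 (μ σ : ℝ) (hσ : 0 < σ) :
    ∫ x, x ^ 2 * gaussDensity μ σ x = σ ^ 2 + μ ^ 2 := by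
  have h := variance_id_gaussianReal (μ := μ) (v := Real.toNNReal (σ ^ 2))
  rw [variance_eq_sub (memLp_id_gaussianReal 2)] at h
  simp only [id, Pi.pow_apply] at h
  rw [integral_id_gaussianReal, Real.coe_toNNReal _ (sq_nonneg σ),
    integral_gaussianReal_eq_integral_smul (by simp [hσ.ne'])] at h
  have : ∫ x, x ^ 2 * gaussDensity μ σ x
      = ∫ x, gaussianPDFReal μ (Real.toNNReal (σ ^ 2)) x • x ^ 2 := by
    simp_rw [gaussDensity_eq μ σ hσ, smul_eq_mul, mul_comm]
  rw [this]; linarith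

lemma measurable_rsign : Measurable Real.sign := by
  unfold Real.sign
  exact Measurable.ite measurableSet_Iio measurable_const
    (Measurable.ite measurableSet_Ioi measurable_const measurable_const)

lemma abs_rsign_le (x : ℝ) : ‖Real.sign x‖ ≤ 1 := by
  unfold Real.sign
  split_ifs <;> simp

lemma gexp_integrable : Integrable (fun t : ℝ => Real.exp (-t ^ 2)) := by
  simpa using integrable_exp_neg_mul_sq (b := 1) one_pos

lemma sign_int (u : ℝ) :
    ∫ t : ℝ, Real.sign (u + t) * Real.exp (-t ^ 2)
      = 2 * ∫ t in (0 : ℝ)..u, Real.exp (-t ^ 2) := by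
  have hI := gexp_integrable
  have hS : Integrable (fun t : ℝ => Real.sign (u + t) * Real.exp (-t ^ 2)) :=
    hI.bdd_mul (c := 1) (measurable_rsign.comp (measurable_const_add u)).aestronglyMeasurable
      (Filter.Eventually.of_forall fun x => abs_rsign_le _)
  rw [← intervalIntegral.integral_Iic_add_Ioi (b := -u) hS.integrableOn hS.integrableOn]
  have h1 : ∫ t in Set.Ioi (-u), Real.sign (u + t) * Real.exp (-t ^ 2)
      = ∫ t in Set.Iic u, Real.exp (-t ^ 2) := by
    rw [← integral_comp_neg_Iic u (fun t => Real.sign (u + t) * Real.exp (-t ^ 2)),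
      integral_Iic_eq_integral_Iio, integral_Iic_eq_integral_Iio]
    refine setIntegral_congr_fun measurableSet_Iio fun t ht => ?_
    have : 0 < u + -t := by have := Set.mem_Iio.1 ht; linarith
    simp [Real.sign_of_pos this]
  have h2 : ∫ t in Set.Iic (-u), Real.sign (u + t) * Real.exp (-t ^ 2)
      = - ∫ t in Set.Iic (-u), Real.exp (-t ^ 2) := by
    rw [integral_Iic_eq_integral_Iio, integral_Iic_eq_integral_Iio, ← MeasureTheory.integral_neg]
    refine setIntegral_congr_fun measurableSet_Iio fun t ht => ?_
    have : u + t < 0 := by have := Set.mem_Iio.1 ht; linarith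
    simp [Real.sign_of_neg this]
  rw [h1, h2]
  have h3 := intervalIntegral.integral_Iic_sub_Iic (a := -u) (b := u) hI.integrableOn hI.integrableOn
  have h4 : ∫ t in (-u)..0, Real.exp (-t ^ 2) = ∫ t in (0:ℝ)..u, Real.exp (-t ^ 2) := by
    have := intervalIntegral.integral_comp_neg (a := -u) (b := 0) (fun t => Real.exp (-t ^ 2))
    simpa using this
  have h5 := intervalIntegral.integral_add_adjacent_intervals (a := -u) (b := 0) (c := u)
    hI.intervalIntegrable hI.intervalIntegrable
  linarith

lemma sign_erf (m s x : ℝ) (hs : 0 < s) :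
    ∫ y, Real.sign (x + y) * gaussDensity m s y = erf ((x + m) / (s * Real.sqrt 2)) := by
  have hc : 0 < s * Real.sqrt 2 := by positivity
  rw [← integral_add_right_eq_self _ m]
  have h := Measure.integral_comp_mul_left
    (fun y => Real.sign (x + (y + m)) * gaussDensity m s (y + m)) (s * Real.sqrt 2)
  rw [abs_of_pos (inv_pos.2 hc), smul_eq_mul, eq_comm, inv_mul_eq_iff_eq_mul₀ hc.ne'] at h
  rw [h, erf]
  have : ∀ t : ℝ, Real.sign (x + (s * Real.sqrt 2 * t + m)) * gaussDensity m s (s * Real.sqrt 2 * t + m)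
      = (Real.sqrt (2 * Real.pi) * s)⁻¹ *
        (Real.sign ((x + m) / (s * Real.sqrt 2) + t) * Real.exp (-t ^ 2)) := by
    intro t
    have e1 : x + (s * Real.sqrt 2 * t + m)
        = (s * Real.sqrt 2) * ((x + m) / (s * Real.sqrt 2) + t) := by
      field_simp; ring
    have e2 : Real.sign (x + (s * Real.sqrt 2 * t + m))
        = Real.sign ((x + m) / (s * Real.sqrt 2) + t) := by
      rw [e1]
      rcases lt_trichotomy ((x + m) / (s * Real.sqrt 2) + t) 0 with h | h | h
      · rw [Real.sign_of_neg h, Real.sign_of_neg (mul_neg_of_pos_of_neg hc h)]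
      · rw [h, mul_zero]
      · rw [Real.sign_of_pos h, Real.sign_of_pos (mul_pos hc h)]
    have e3 : -(s * Real.sqrt 2 * t + m - m) ^ 2 / (2 * s ^ 2) = -t ^ 2 := by
      rw [add_sub_cancel_right, mul_pow, mul_pow, Real.sq_sqrt (by norm_num)]
      field_simp
    rw [e2, gaussDensity, e3]; ring
  simp_rw [this]
  rw [MeasureTheory.integral_const_mul, sign_int, Real.sqrt_mul (by norm_num) Real.pi]
  field_simp

lemma biGauss_factor (μi μmi σi σmi ρ : ℝ) (hσi : 0 < σi) (hσmi : 0 < σmi)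
    (hρ : 0 < 1 - ρ ^ 2) (x : ℝ × ℝ) :
    biGaussDensity μi μmi σi σmi ρ x = gaussDensity μi σi x.1 *
      gaussDensity (μmi + ρ * σmi / σi * (x.1 - μi)) (σmi * Real.sqrt (1 - ρ ^ 2)) x.2 := by
  unfold biGaussDensity gaussDensity
  rw [mul_mul_mul_comm, ← Real.exp_add]
  congr 1
  · rw [← mul_inv]
    congr 1
    have : Real.sqrt (2 * Real.pi) * Real.sqrt (2 * Real.pi) = 2 * Real.pi :=
      Real.mul_self_sqrt (by positivity)
    linear_combination (-(σi * σmi * Real.sqrt (1 - ρ ^ 2))) * this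
  · congr 1
    rw [mul_pow, Real.sq_sqrt hρ.le]
    have := hρ.ne'
    field_simp
    ring

lemma gd_shift (m s y : ℝ) : gaussDensity m s y = gaussDensity 0 s (y - m) := by
  simp [gaussDensity]

/-- Integrability of `xʲ zᵏ` against the factored density, with `z = y - (α x + β)`. -/
lemma mono_integrable (μ σ s α β : ℝ) (hσ : 0 < σ) (hs : 0 < s) (j k : ℕ) :
    Integrable (fun x : ℝ × ℝ => x.1 ^ j * (x.2 - (α * x.1 + β)) ^ k *
      (gaussDensity μ σ x.1 * gaussDensity (α * x.1 + β) s x.2)) := by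
  have hT : MeasurePreserving (fun p : ℝ × ℝ => (id p.1, (fun x y => y - (α * x + β)) p.1 p.2))
      (volume.prod volume) (volume.prod volume) := by
    refine (MeasurePreserving.id volume).skew_product (g := fun x y => y - (α * x + β)) ?_ ?_
    · simp only [Function.uncurry_def]; fun_prop
    · exact Filter.Eventually.of_forall fun x => (measurePreserving_sub_right volume _).map_eq
  have hG := (gd_integrable μ σ hσ j).mul_prod (gd_integrable 0 s hs k)
  have := (hT.integrable_comp hG.aestronglyMeasurable).2 hG
  refine this.congr (Filter.Eventually.of_forall fun x => ?_)
  simp only [Function.comp, id]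
  rw [gd_shift (α * x.1 + β)]
  ring

/-- Closed form of the expected average buying cost under correlated
(bivariate normal) prediction errors and piecewise-linear symmetric pricing.
(Expected-ABC theorem in the proof of Theorem 7.) -/
theorem expected_ABC_correlated_gaussian
    (μi μmi σi σmi ρ : ℝ) (hσi : 0 < σi) (hσmi : 0 < σmi)
    (hρ : ρ ∈ Set.Ioo (-1 : ℝ) 1)
    (Di pd a₁ a₂ b₁ b₂ : ℝ)
    (hD : 0 < Di) (hpd : 0 < pd) (ha : a₁ = a₂) (ha1 : 0 < a₁)
    (hb : b₁ + b₂ = 2) (hb12 : b₂ < b₁) (hb2 : 0 < b₂) :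
    (∫ x : ℝ × ℝ,
        (pd + x.1 * (spotPrice a₁ a₂ b₁ b₂ pd (x.1 + x.2) - pd) / Di)
          * biGaussDensity μi μmi σi σmi ρ x)
      = pd + (pd / Di) *
          ((a₁ + a₂) / 2 * (σi ^ 2 + μi ^ 2 + μi * μmi + ρ * σi * σmi)
            + (b₁ - b₂) / 2 *
              ∫ δ : ℝ,
                δ * erf (((δ + μmi) / σmi + ρ * (δ - μi) / σi)
                    / Real.sqrt (2 * (1 - ρ ^ 2)))
                  * gaussDensity μi σi δ) := by
  have hr : 0 < 1 - ρ ^ 2 := by nlinarith [hρ.1, hρ.2]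
  have hs : 0 < σmi * Real.sqrt (1 - ρ ^ 2) := by positivity
  obtain ⟨s, hsdef⟩ : ∃ s, s = σmi * Real.sqrt (1 - ρ ^ 2) := ⟨_, rfl⟩
  obtain ⟨α, hα⟩ : ∃ α, α = ρ * σmi / σi := ⟨_, rfl⟩
  obtain ⟨β, hβ⟩ : ∃ β, β = μmi - α * μi := ⟨_, rfl⟩
  rw [← hsdef] at hs
  have hbi : ∀ x : ℝ × ℝ, biGaussDensity μi μmi σi σmi ρ x
      = gaussDensity μi σi x.1 * gaussDensity (α * x.1 + β) s x.2 := by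
    intro x
    rw [biGauss_factor μi μmi σi σmi ρ hσi hσmi hr, ← hsdef, ← hα, hβ]
    congr 2; ring
  have hspot : ∀ t, spotPrice a₁ a₂ b₁ b₂ pd t - pd
      = pd * (a₁ * t + (b₁ - b₂) / 2 * Real.sign t) := by
    intro t
    have hb' : b₂ = 2 - b₁ := by linarith
    unfold spotPrice
    rcases lt_trichotomy t 0 with h | h | h
    · rw [if_neg h.not_gt, if_pos h, Real.sign_of_neg h, ← ha, hb']; ring
    · subst h; simp
    · rw [if_pos h, Real.sign_of_pos h, hb']; ring
  -- the three integrable pieces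
  have hM := fun j k => mono_integrable μi σi s α β hσi hs j k
  have iA : Integrable (fun x : ℝ × ℝ =>
      gaussDensity μi σi x.1 * gaussDensity (α * x.1 + β) s x.2) := by
    simpa using hM 0 0
  have iB : Integrable (fun x : ℝ × ℝ => x.1 * (x.1 + x.2) *
      (gaussDensity μi σi x.1 * gaussDensity (α * x.1 + β) s x.2)) := by
    refine ((((hM 2 0).const_mul (1 + α)).add ((hM 1 0).const_mul β)).add (hM 1 1)).congr
      (Filter.Eventually.of_forall fun x => ?_)
    simp only [Pi.add_apply]
    ring
  have iC : Integrable (fun x : ℝ × ℝ => Real.sign (x.1 + x.2) * (x.1 *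
      (gaussDensity μi σi x.1 * gaussDensity (α * x.1 + β) s x.2))) := by
    refine Integrable.bdd_mul (c := 1) (by simpa using hM 1 0)
      (measurable_rsign.comp (measurable_fst.add measurable_snd)).aestronglyMeasurable
      (Filter.Eventually.of_forall fun x => abs_rsign_le _)
  have vA : ∫ x : ℝ × ℝ, gaussDensity μi σi x.1 * gaussDensity (α * x.1 + β) s x.2 = 1 := by
    rw [Measure.volume_eq_prod] at iA ⊢
    rw [integral_prod _ iA]
    simp only [MeasureTheory.integral_const_mul, gd_int0 _ s hs, mul_one, gd_int0 _ σi hσi]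
  have vB : ∫ x : ℝ × ℝ, x.1 * (x.1 + x.2) *
      (gaussDensity μi σi x.1 * gaussDensity (α * x.1 + β) s x.2)
      = σi ^ 2 + μi ^ 2 + μi * μmi + ρ * σi * σmi := by
    rw [Measure.volume_eq_prod] at iB ⊢
    rw [integral_prod _ iB]
    have inner : ∀ x : ℝ, ∫ y : ℝ, x * (x + y) *
        (gaussDensity μi σi x * gaussDensity (α * x + β) s y)
        = (1 + α) * (x ^ 2 * gaussDensity μi σi x) + β * (x * gaussDensity μi σi x) := by
      intro x
      have e : ∀ y : ℝ, x * (x + y) * (gaussDensity μi σi x * gaussDensity (α * x + β) s y)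
          = (x ^ 2 * gaussDensity μi σi x) * gaussDensity (α * x + β) s y
            + (x * gaussDensity μi σi x) * (y * gaussDensity (α * x + β) s y) := by
        intro y; ring
      simp_rw [e]
      rw [MeasureTheory.integral_add, MeasureTheory.integral_const_mul,
        MeasureTheory.integral_const_mul, gd_int0 _ s hs, gd_int1 _ s hs]
      · ring
      · exact Integrable.const_mul (by simpa using gd_integrable (α * x + β) s hs 0) _
      · exact Integrable.const_mul (by simpa using gd_integrable (α * x + β) s hs 1) _
    simp only [inner]
    rw [MeasureTheory.integral_add, MeasureTheory.integral_const_mul,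
        MeasureTheory.integral_const_mul, gd_int1 _ σi hσi, gd_int2 _ σi hσi, hβ, hα]
    · field_simp; ring
    · exact (gd_integrable μi σi hσi 2).const_mul _
    · exact Integrable.const_mul (by simpa using gd_integrable μi σi hσi 1) _
  have vC : ∫ x : ℝ × ℝ, Real.sign (x.1 + x.2) * (x.1 *
      (gaussDensity μi σi x.1 * gaussDensity (α * x.1 + β) s x.2))
      = ∫ δ : ℝ, δ * erf (((δ + μmi) / σmi + ρ * (δ - μi) / σi)
          / Real.sqrt (2 * (1 - ρ ^ 2))) * gaussDensity μi σi δ := by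
    rw [Measure.volume_eq_prod] at iC ⊢
    rw [integral_prod _ iC]
    refine MeasureTheory.integral_congr_ae (Filter.Eventually.of_forall fun x => ?_)
    have e : ∀ y : ℝ, Real.sign (x + y) * (x *
        (gaussDensity μi σi x * gaussDensity (α * x + β) s y))
        = (x * gaussDensity μi σi x) * (Real.sign (x + y) * gaussDensity (α * x + β) s y) := by
      intro y; ring
    simp only [e]
    rw [MeasureTheory.integral_const_mul, sign_erf _ s x hs]
    have : (x + (α * x + β)) / (s * Real.sqrt 2) = ((x + μmi) / σmi + ρ * (x - μi) / σi)
          / Real.sqrt (2 * (1 - ρ ^ 2)) := by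
      have h1 : 0 < Real.sqrt (1 - ρ ^ 2) := by positivity
      rw [Real.sqrt_mul (by norm_num), hsdef, hβ, hα]
      field_simp
      ring
    rw [this]; ring
  have key : ∀ x : ℝ × ℝ, (pd + x.1 * (spotPrice a₁ a₂ b₁ b₂ pd (x.1 + x.2) - pd) / Di)
          * biGaussDensity μi μmi σi σmi ρ x
      = pd * (gaussDensity μi σi x.1 * gaussDensity (α * x.1 + β) s x.2)
        + (pd / Di * a₁) * (x.1 * (x.1 + x.2) *
      (gaussDensity μi σi x.1 * gaussDensity (α * x.1 + β) s x.2))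
        + (pd / Di * ((b₁ - b₂) / 2)) * (Real.sign (x.1 + x.2) * (x.1 *
      (gaussDensity μi σi x.1 * gaussDensity (α * x.1 + β) s x.2))) := by
    intro x
    rw [hbi, hspot]; ring
  simp_rw [key]
  rw [MeasureTheory.integral_add (by exact (iA.const_mul _).add (iB.const_mul _))
    (iC.const_mul _), MeasureTheory.integral_add (iA.const_mul _) (iB.const_mul _),
    MeasureTheory.integral_const_mul, MeasureTheory.integral_const_mul,
    MeasureTheory.integral_const_mul, vA, vB, vC, ← ha]
  ring
end

section
/- Let σ_i > 0, σ_{−i} > 0, ρ ∈ [0, 1), and set k₁ := (1/σ_{−i} + ρ/σ_i)/√(2(1−ρ²)) and k₂ := σ_i/(σ_i + ρ·σ_{−i}). Define V(m) := ∫_ℝ x · erf( k₁·(x + k₂·m) ) · (1/(√(2π)σ_i)) e^{−x²/(2σ_i²)} dx, where erf(z) = (2/√π)·∫₀ᶻ e^{−t²} dt. Then V is differentiable, V′(0) = 0, V′(m) > 0 for every m < 0 and V′(m) < 0 for every m > 0; hence V attains its maximum at m = 0 and V is decreasing with respect to |m|. Consequently, under piecewise-linear symmetric pricing with b₁ > b₂,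 a rational utility bidding according to prediction (μ_i = 0) has its expected average buying cost maximized when the aggregate deviation of all other utilities is 0 and decreasing as |μ_{−i}| grows; i.e., the equilibrium is (0, N−1) fault immune for nonnegatively correlated Gaussian errors. -/
open MeasureTheory intervalIntegral

lemma erf_hasDerivAt (z : ℝ) :
    HasDerivAt erf (2 / Real.sqrt Real.pi * Real.exp (-z ^ 2)) z := by
  have hc : Continuous (fun t : ℝ => Real.exp (-t ^ 2)) := by fun_prop
  exact ((hc.integral_hasStrictDerivAt 0 z).hasDerivAt).const_mul (2 / Real.sqrt Real.pi)

lemma erf_continuous : Continuous erf :=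
  continuous_iff_continuousAt.2 fun z => (erf_hasDerivAt z).continuousAt

lemma erf_bounded : ∃ B : ℝ, ∀ z, |erf z| ≤ B := by
  have hint : Integrable (fun t : ℝ => Real.exp (-t ^ 2)) := by
    simpa using integrable_exp_neg_mul_sq (b := 1) one_pos
  refine ⟨(2 / Real.sqrt Real.pi) * ∫ t : ℝ, Real.exp (-t ^ 2), fun z => ?_⟩
  unfold erf
  rw [abs_mul, abs_of_nonneg (by positivity : 0 ≤ 2 / Real.sqrt Real.pi)]
  refine mul_le_mul_of_nonneg_left ?_ (by positivity)
  rw [← Real.norm_eq_abs]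
  refine norm_integral_le_integral_norm_uIoc.trans ?_
  simp only [Real.norm_eq_abs, Real.abs_exp]
  exact setIntegral_le_integral hint (Filter.Eventually.of_forall fun t => (Real.exp_pos _).le)

lemma integral_mul_gauss {c : ℝ} :
    ∫ x : ℝ, x * Real.exp (-c * x ^ 2) = 0 := by
  have h := integral_neg_eq_self (fun x : ℝ => x * Real.exp (-c * x ^ 2)) volume
  simp only [neg_sq, neg_mul, MeasureTheory.integral_neg] at h
  simp only [neg_mul]
  linarith

/-- First moment of a product of two shifted Gaussians. -/
lemma integral_shift {a b d : ℝ} (ha : 0 < a) (hb : 0 < b) :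
    ∫ x : ℝ, x * Real.exp (-a * (x + d) ^ 2) * Real.exp (-b * x ^ 2)
      = -(a / (a + b)) * Real.sqrt (Real.pi / (a + b)) * d
          * Real.exp (-(a * b / (a + b)) * d ^ 2) := by
  have hab : 0 < a + b := by positivity
  have e : ∀ x : ℝ, x * Real.exp (-a * (x + d) ^ 2) * Real.exp (-b * x ^ 2)
      = (fun y : ℝ => Real.exp (-(a * b / (a + b)) * d ^ 2) *
          (y * Real.exp (-(a + b) * y ^ 2) - a / (a + b) * d * Real.exp (-(a + b) * y ^ 2)))
        (x + a / (a + b) * d) := by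
    intro x
    have h1 : Real.exp (-a * (x + d) ^ 2) * Real.exp (-b * x ^ 2)
        = Real.exp (-(a * b / (a + b)) * d ^ 2)
          * Real.exp (-(a + b) * (x + a / (a + b) * d) ^ 2) := by
      rw [← Real.exp_add, ← Real.exp_add]
      congr 1
      field_simp
      ring
    rw [mul_assoc, h1]
    ring
  rw [MeasureTheory.integral_congr_ae (Filter.Eventually.of_forall e)]
  rw [integral_add_right_eq_self (fun y : ℝ => Real.exp (-(a * b / (a + b)) * d ^ 2) *
          (y * Real.exp (-(a + b) * y ^ 2) - a / (a + b) * d * Real.exp (-(a + b) * y ^ 2))), MeasureTheory.integral_const_mul,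
    MeasureTheory.integral_sub (integrable_mul_exp_neg_mul_sq hab)
      ((integrable_exp_neg_mul_sq hab).const_mul _),
    MeasureTheory.integral_const_mul, integral_mul_gauss, integral_gaussian]
  ring

lemma V_hasDerivAt {k₁ k₂ b C : ℝ} (h1 : 0 < k₁) (h2 : 0 < k₂) (hb : 0 < b) (hC : 0 < C) :
    ∃ K L : ℝ, 0 < K ∧ 0 < L ∧ ∀ m : ℝ,
      HasDerivAt (fun m : ℝ => ∫ x : ℝ, x * erf (k₁ * (x + k₂ * m)) * (C * Real.exp (-b * x ^ 2)))
        (-K * m * Real.exp (-L * m ^ 2)) m := by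
  have hpi := Real.pi_pos
  have ha : 0 < k₁ ^ 2 := by positivity
  set D : ℝ := 2 / Real.sqrt Real.pi * k₁ * k₂ * C with hD
  have hDpos : 0 < D := by positivity
  refine ⟨D * (k₁ ^ 2 / (k₁ ^ 2 + b) * Real.sqrt (Real.pi / (k₁ ^ 2 + b)) * k₂),
    k₁ ^ 2 * b / (k₁ ^ 2 + b) * k₂ ^ 2, by positivity, by positivity, fun m => ?_⟩
  obtain ⟨B, hB⟩ := erf_bounded
  have hcont := erf_continuous
  have key := hasDerivAt_integral_of_dominated_loc_of_deriv_le (μ := volume) (𝕜 := ℝ)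
    (F := fun m x : ℝ => x * erf (k₁ * (x + k₂ * m)) * (C * Real.exp (-b * x ^ 2)))
    (F' := fun m x : ℝ => D * (x * Real.exp (-k₁ ^ 2 * (x + k₂ * m) ^ 2) * Real.exp (-b * x ^ 2)))
    (bound := fun x : ℝ => D * |x * Real.exp (-b * x ^ 2)|) (x₀ := m) (s := Set.univ)
    Filter.univ_mem
    (Filter.Eventually.of_forall fun m => by
      apply Continuous.aestronglyMeasurable; fun_prop)
    (by
      refine Integrable.mono' (g := fun x : ℝ => (B * C) * |x * Real.exp (-b * x ^ 2)|)
        (((integrable_mul_exp_neg_mul_sq hb).abs).const_mul _)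
        (by apply Continuous.aestronglyMeasurable; fun_prop)
        (Filter.Eventually.of_forall fun x => ?_)
      rw [Real.norm_eq_abs, show x * erf (k₁ * (x + k₂ * m)) * (C * Real.exp (-b * x ^ 2))
        = erf (k₁ * (x + k₂ * m)) * C * (x * Real.exp (-b * x ^ 2)) by ring, abs_mul, abs_mul,
        abs_of_pos hC]
      gcongr
      exact hB _)
    (by apply Continuous.aestronglyMeasurable; fun_prop)
    (Filter.Eventually.of_forall fun x m _ => by
      rw [Real.norm_eq_abs, abs_mul, abs_of_pos hDpos]
      refine mul_le_mul_of_nonneg_left ?_ hDpos.le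
      rw [abs_mul, abs_mul, abs_mul, Real.abs_exp, Real.abs_exp]
      have : Real.exp (-k₁ ^ 2 * (x + k₂ * m) ^ 2) ≤ 1 := by
        apply Real.exp_le_one_iff.2
        rw [neg_mul, neg_nonpos]
        positivity
      have h0 : 0 ≤ |x| := abs_nonneg x
      gcongr
      nlinarith)
    (((integrable_mul_exp_neg_mul_sq hb).abs).const_mul _)
    (Filter.Eventually.of_forall fun x m _ => by
      have hin : HasDerivAt (fun m : ℝ => k₁ * (x + k₂ * m)) (k₁ * (k₂ * 1)) m :=
        (((hasDerivAt_id m).const_mul k₂).const_add x).const_mul k₁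
      have := (((erf_hasDerivAt (k₁ * (x + k₂ * m))).comp m hin).const_mul x).mul_const
        (C * Real.exp (-b * x ^ 2))
      refine this.congr_deriv ?_
      rw [show -(k₁ * (x + k₂ * m)) ^ 2 = -k₁ ^ 2 * (x + k₂ * m) ^ 2 by ring, hD]
      ring)
  refine key.2.congr_deriv ?_
  rw [MeasureTheory.integral_const_mul, integral_shift ha hb,
    show -(k₁ ^ 2 * b / (k₁ ^ 2 + b)) * (k₂ * m) ^ 2
      = -(k₁ ^ 2 * b / (k₁ ^ 2 + b) * k₂ ^ 2) * m ^ 2 by ring]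
  ring

/-- The discontinuity-gap term of a rational utility's expected cost under
nonnegatively correlated Gaussian errors, as a function of the aggregate
deviation `m` of the other utilities, has vanishing derivative at `0`, positive
derivative for `m < 0`, negative derivative for `m > 0`; hence it is maximized
at `m = 0` and decreasing in `|m|`. (Robustness part of Theorem 7.) -/
theorem correlated_gaussian_fault_immune
    (σi σmi ρ : ℝ) (hσi : 0 < σi) (hσmi : 0 < σmi)
    (hρ : ρ ∈ Set.Ico (0 : ℝ) 1)
    (k₁ k₂ : ℝ)
    (hk₁ : k₁ = (1 / σmi + ρ / σi) / Real.sqrt (2 * (1 - ρ ^ 2)))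
    (hk₂ : k₂ = σi / (σi + ρ * σmi))
    (V : ℝ → ℝ)
    (hV : ∀ m, V m = ∫ x : ℝ,
      x * erf (k₁ * (x + k₂ * m))
        * ((Real.sqrt (2 * Real.pi) * σi)⁻¹
            * Real.exp (-x ^ 2 / (2 * σi ^ 2)))) :
    Differentiable ℝ V ∧
    deriv V 0 = 0 ∧
    (∀ m : ℝ, m < 0 → 0 < deriv V m) ∧
    (∀ m : ℝ, 0 < m → deriv V m < 0) ∧
    (∀ m : ℝ, V m ≤ V 0) ∧
    (∀ m₁ m₂ : ℝ, |m₂| < |m₁| → V m₁ < V m₂) := by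
  obtain ⟨h0, hr1⟩ := hρ
  have hs : 0 < 2 * (1 - ρ ^ 2) := by nlinarith
  have hk1 : 0 < k₁ := by rw [hk₁]; positivity
  have hk2 : 0 < k₂ := by rw [hk₂]; positivity
  have hpi := Real.pi_pos
  obtain ⟨K, L, hK, hL, hder⟩ := V_hasDerivAt (b := 1 / (2 * σi ^ 2))
    (C := (Real.sqrt (2 * Real.pi) * σi)⁻¹) hk1 hk2 (by positivity) (by positivity)
  have hVeq : V = fun m : ℝ => ∫ x : ℝ, x * erf (k₁ * (x + k₂ * m)) *
      ((Real.sqrt (2 * Real.pi) * σi)⁻¹ * Real.exp (-(1 / (2 * σi ^ 2)) * x ^ 2)) := by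
    funext m
    rw [hV]
    congr 1
    funext x
    rw [show -x ^ 2 / (2 * σi ^ 2) = -(1 / (2 * σi ^ 2)) * x ^ 2 by ring]
  rw [← hVeq] at hder
  have hE : ∀ m : ℝ, HasDerivAt (fun m : ℝ => K / (2 * L) * Real.exp (-L * m ^ 2))
      (-K * m * Real.exp (-L * m ^ 2)) m := by
    intro m
    have := ((((hasDerivAt_id m).pow 2).const_mul (-L)).exp).const_mul (K / (2 * L))
    refine this.congr_deriv ?_
    simp
    field_simp
  have hform : ∀ x y : ℝ, V x - K / (2 * L) * Real.exp (-L * x ^ 2)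
      = V y - K / (2 * L) * Real.exp (-L * y ^ 2) := by
    apply is_const_of_deriv_eq_zero (𝕜 := ℝ)
      (f := fun m => V m - K / (2 * L) * Real.exp (-L * m ^ 2))
    · exact fun m => ((hder m).sub (hE m)).differentiableAt
    · intro m
      exact ((hder m).sub (hE m)).deriv.trans (sub_self _)
  have hKL : 0 < K / (2 * L) := by positivity
  refine ⟨fun m => (hder m).differentiableAt, ?_, ?_, ?_, ?_, ?_⟩
  · rw [(hder 0).deriv]; simp
  · intro m hm
    rw [(hder m).deriv]
    exact mul_pos (by nlinarith) (Real.exp_pos _)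
  · intro m hm
    rw [(hder m).deriv]
    exact mul_neg_of_neg_of_pos (by nlinarith) (Real.exp_pos _)
  · intro m
    have h := hform m 0
    have h3 : Real.exp (-L * m ^ 2) ≤ Real.exp (-L * 0 ^ 2) := by
      apply Real.exp_le_exp.2
      nlinarith [sq_nonneg m]
    have := mul_le_mul_of_nonneg_left h3 hKL.le
    linarith
  · intro m₁ m₂ hm
    have h := hform m₁ m₂
    have h3 : Real.exp (-L * m₁ ^ 2) < Real.exp (-L * m₂ ^ 2) := by
      apply Real.exp_lt_exp.2
      have := sq_lt_sq.2 hm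
      nlinarith
    have := mul_lt_mul_of_pos_left h3 hKL
    linarith
end
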